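/- arXiv:1712.03895 — 2 statements merged into one kernel-verified Lean document; each statement's English description precedes it below -/
import Mathlib

section
/- Let ω = A dx + B dy with A, B ∈ ℂ[x,y] homogeneous of degree 3 and gcd(A,B) = 1; set C = xA + yB and D = A_x B_y − A_y B_x. Then the following two conditions hold — (1) for every linear form ℓ = ax + by dividing D with multiplicity exactly 1 and not dividing C, the linear form A(b,−a)·x + B(b,−a)·y divides C; (2) for every linear form ℓ = ax + by dividing D with multiplicity exactly 2 and not dividing C, ℓ divides B_x − A_y — if and only if ω is linearly conjugate to one of the following eleven 1-forms: ω₁ = y³dx − x³dy; ω₂ = x³dx − y³dy; ω₃ = y²(3x+y)dx − x²(x+3y)dy; ω₄ = y²(3x+y)dx + x²(x+3y)dy; ω₅ = 2y³dx + x²(3y−2x)dy; ω₆ = (4x³−6x²y+4y³)dx + x²(3y−2x)dy; ω₇ = y³dx + x(3y²−x²)dy; ω₈ = x(x²−3y²)dx − 4y³dy; ω₉ = y²((−3+i√3)x+2y)dx + x²((1+i√3)x − 2i√3·y)dy; ω₁₀ = (3x+√3·y)y²dx + (3y−√3·x)x²dy; ω₁₁ = (3x³+3√3x²y+3xy²+√3y³)dx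 + (√3x³+3x²y+3√3xy²+3y³)dy. Moreover, these eleven 1-forms are pairwise not linearly conjugate, so exactly eleven conjugacy classes occur. -/
open MvPolynomial

noncomputable section

/-- The linear form `a·x + b·y ∈ ℂ[x,y]` attached to a pair `(a, b) ∈ ℂ²`. -/
def lin (v : ℂ × ℂ) : MvPolynomial (Fin 2) ℂ := C v.1 * X 0 + C v.2 * X 1

/-- Substitution of the linear change of variables on `ℂ²` given by the matrix `M`. -/
def subst2 (M : Matrix (Fin 2) (Fin 2) ℂ) (P : MvPolynomial (Fin 2) ℂ) :
    MvPolynomial (Fin 2) ℂ :=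
  aeval (fun i => ∑ j, C (M i j) * X j) P

/-- The 1-forms `ω = A dx + B dy` and `ω' = A' dx + B' dy` are linearly conjugate:
there are `T ∈ GL₂(ℂ)` and `c ∈ ℂ*` with `T*ω = c·ω'`. -/
def LinConj2 (A B A' B' : MvPolynomial (Fin 2) ℂ) : Prop :=
  ∃ (M : Matrix (Fin 2) (Fin 2) ℂ) (c : ℂ), IsUnit M.det ∧ c ≠ 0 ∧
    C (M 0 0) * subst2 M A + C (M 1 0) * subst2 M B = C c * A' ∧
    C (M 0 1) * subst2 M A + C (M 1 1) * subst2 M B = C c * B'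

/-- The inflection polynomial `D = A_x·B_y − A_y·B_x` of the homogeneous 1-form
`ω = A dx + B dy`. -/
def Dpoly (A B : MvPolynomial (Fin 2) ℂ) : MvPolynomial (Fin 2) ℂ :=
  pderiv 0 A * pderiv 1 B - pderiv 1 A * pderiv 0 B

/-- The tangent cone `C = x·A + y·B` of the homogeneous 1-form `ω = A dx + B dy`. -/
def cone (A B : MvPolynomial (Fin 2) ℂ) : MvPolynomial (Fin 2) ℂ :=
  X 0 * A + X 1 * B

/-- `√3` as a complex number. -/
def s3 : ℂ := (Real.sqrt 3 : ℝ)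

/-- The eleven homogeneous 1-forms of degree 3 with flat dual 3-web. -/
def omegaList : Fin 11 → MvPolynomial (Fin 2) ℂ × MvPolynomial (Fin 2) ℂ :=
  ![(X 1 ^ 3, -(X 0 ^ 3)),
    (X 0 ^ 3, -(X 1 ^ 3)),
    (3 * X 0 * X 1 ^ 2 + X 1 ^ 3, -(X 0 ^ 3 + 3 * X 0 ^ 2 * X 1)),
    (3 * X 0 * X 1 ^ 2 + X 1 ^ 3, X 0 ^ 3 + 3 * X 0 ^ 2 * X 1),
    (2 * X 1 ^ 3, 3 * X 0 ^ 2 * X 1 - 2 * X 0 ^ 3),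
    (4 * X 0 ^ 3 - 6 * X 0 ^ 2 * X 1 + 4 * X 1 ^ 3, 3 * X 0 ^ 2 * X 1 - 2 * X 0 ^ 3),
    (X 1 ^ 3, 3 * X 0 * X 1 ^ 2 - X 0 ^ 3),
    (X 0 ^ 3 - 3 * X 0 * X 1 ^ 2, -(4 * X 1 ^ 3)),
    (C (-3 + Complex.I * s3) * X 0 * X 1 ^ 2 + 2 * X 1 ^ 3,
      C (1 + Complex.I * s3) * X 0 ^ 3 - C (2 * (Complex.I * s3)) * X 0 ^ 2 * X 1),
    (3 * X 0 * X 1 ^ 2 + C s3 * X 1 ^ 3, 3 * X 0 ^ 2 * X 1 - C s3 * X 0 ^ 3),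
    (3 * X 0 ^ 3 + C (3 * s3) * X 0 ^ 2 * X 1 + 3 * X 0 * X 1 ^ 2 + C s3 * X 1 ^ 3,
      C s3 * X 0 ^ 3 + 3 * X 0 ^ 2 * X 1 + C (3 * s3) * X 0 * X 1 ^ 2 + 3 * X 1 ^ 3)]

/-! ### Points, divisibility and evaluation -/

def KK (A B : MvPolynomial (Fin 2) ℂ) (n : ℕ) (p : ℂ × ℂ) : Prop :=
  lin (-p.2, p.1) ^ n ∣ Dpoly A B
def Fx (A B : MvPolynomial (Fin 2) ℂ) (p : ℂ × ℂ) : Prop :=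
  lin (-p.2, p.1) ∣ cone A B
def Wd (A B : MvPolynomial (Fin 2) ℂ) (p : ℂ × ℂ) : Prop :=
  lin (-p.2, p.1) ∣ (pderiv 0 B - pderiv 1 A)
def Nx (A B : MvPolynomial (Fin 2) ℂ) (p : ℂ × ℂ) : Prop :=
  lin (eval ![p.1, p.2] A, eval ![p.1, p.2] B) ∣ cone A B

def FlatP (A B : MvPolynomial (Fin 2) ℂ) : Prop :=
  (∀ p : ℂ × ℂ, p ≠ 0 → KK A B 1 p → ¬ KK A B 2 p → ¬ Fx A B p → Nx A B p) ∧
  (∀ p : ℂ × ℂ, p ≠ 0 → KK A B 2 p → ¬ KK A B 3 p → ¬ Fx A B p → Wd A B p)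

theorem flatP_iff (A B : MvPolynomial (Fin 2) ℂ) :
    ((∀ a b : ℂ, (a, b) ≠ (0, 0) →
        lin (a, b) ∣ Dpoly A B → ¬ lin (a, b) ^ 2 ∣ Dpoly A B →
        ¬ lin (a, b) ∣ cone A B →
        lin (eval ![b, -a] A, eval ![b, -a] B) ∣ cone A B) ∧
      (∀ a b : ℂ, (a, b) ≠ (0, 0) →
        lin (a, b) ^ 2 ∣ Dpoly A B → ¬ lin (a, b) ^ 3 ∣ Dpoly A B →
        ¬ lin (a, b) ∣ cone A B →
        lin (a, b) ∣ (pderiv 0 B - pderiv 1 A))) ↔ FlatP A B := by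
  constructor
  · rintro ⟨h1, h2⟩
    refine ⟨fun p hp a b c => ?_, fun p hp a b c => ?_⟩
    · have := h1 (-p.2) p.1 (by
        intro h; apply hp; simp only [Prod.mk.injEq, neg_eq_zero] at h
        exact Prod.ext h.2 h.1) (by simpa [KK] using a) b c
      simpa [Nx] using this
    · exact h2 (-p.2) p.1 (by
        intro h; apply hp; simp only [Prod.mk.injEq, neg_eq_zero] at h
        exact Prod.ext h.2 h.1) a b c
  · rintro ⟨h1, h2⟩
    refine ⟨fun a b hp x y z => ?_, fun a b hp x y z => ?_⟩
    · have := h1 (b, -a) (by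
        intro h; apply hp; simp only [Prod.mk_eq_zero, neg_eq_zero] at h
        simp [h.1, h.2]) (by simpa [KK] using x) (by simpa [KK] using y) (by simpa [Fx] using z)
      simpa [Nx] using this
    · have := h2 (b, -a) (by
        intro h; apply hp; simp only [Prod.mk_eq_zero, neg_eq_zero] at h
        simp [h.1, h.2]) (by simpa [KK] using x) (by simpa [KK] using y) (by simpa [Fx] using z)
      simpa [Wd] using this

theorem eval_subst2 (M : Matrix (Fin 2) (Fin 2) ℂ) (P : MvPolynomial (Fin 2) ℂ)
    (v : Fin 2 → ℂ) : eval v (subst2 M P) = eval (M.mulVec v) P := by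
  unfold subst2
  have : (eval v).comp (aeval (R := ℂ) (fun i => ∑ j, C (M i j) * X j) :
      MvPolynomial (Fin 2) ℂ →ₐ[ℂ] MvPolynomial (Fin 2) ℂ).toRingHom = eval (M.mulVec v) := by
    apply MvPolynomial.ringHom_ext
    · intro r; simp
    · intro i; fin_cases i <;> simp [Fin.sum_univ_two]
  exact congrArg (fun f => f P) this

theorem subst2_add (M) (P Q) : subst2 M (P + Q) = subst2 M P + subst2 M Q := by simp [subst2]
theorem subst2_sub (M) (P Q) : subst2 M (P - Q) = subst2 M P - subst2 M Q := by simp [subst2]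
theorem subst2_mul (M) (P Q) : subst2 M (P * Q) = subst2 M P * subst2 M Q := by simp [subst2]
theorem subst2_pow (M) (P) (n : ℕ) : subst2 M (P ^ n) = subst2 M P ^ n := by simp [subst2]
theorem subst2_C (M) (r) : subst2 M (C r) = C r := by simp [subst2]
theorem subst2_X (M) (i) : subst2 M (X i) = C (M i 0) * X 0 + C (M i 1) * X 1 := by
  simp [subst2, Fin.sum_univ_two]

theorem subst2_inv (M : Matrix (Fin 2) (Fin 2) ℂ) (h : IsUnit M.det) (P) :
    subst2 M⁻¹ (subst2 M P) = P := by
  apply MvPolynomial.funext; intro v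
  rw [eval_subst2, eval_subst2, Matrix.mulVec_mulVec, Matrix.mul_nonsing_inv _ h, Matrix.one_mulVec]

theorem subst2_dvd (M : Matrix (Fin 2) (Fin 2) ℂ) (h : IsUnit M.det) (P Q) :
    subst2 M P ∣ subst2 M Q ↔ P ∣ Q := by
  constructor
  · rintro ⟨R, hR⟩
    refine ⟨subst2 M⁻¹ R, ?_⟩
    rw [← subst2_inv M h Q, hR, subst2_mul, subst2_inv M h]
  · rintro ⟨R, rfl⟩
    exact ⟨subst2 M R, subst2_mul _ _ _⟩

theorem pderiv_subst2 (M : Matrix (Fin 2) (Fin 2) ℂ) (j : Fin 2) (P) :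
    pderiv j (subst2 M P) =
      C (M 0 j) * subst2 M (pderiv 0 P) + C (M 1 j) * subst2 M (pderiv 1 P) := by
  induction P using MvPolynomial.induction_on with
  | C a => simp [subst2]
  | add p q hp hq => simp only [subst2_add, map_add, hp, hq]; ring
  | mul_X p i hp =>
    simp only [subst2_mul, Derivation.leibniz, smul_eq_mul, subst2_add, hp, subst2_X, map_add,
      pderiv_C, pderiv_X]
    fin_cases i <;> fin_cases j <;> simp [subst2] <;> ring

def mv (M : Matrix (Fin 2) (Fin 2) ℂ) (p : ℂ × ℂ) : ℂ × ℂ :=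
  (M 0 0 * p.1 + M 0 1 * p.2, M 1 0 * p.1 + M 1 1 * p.2)

theorem mulVec_eq (M : Matrix (Fin 2) (Fin 2) ℂ) (p : ℂ × ℂ) :
    M.mulVec ![p.1, p.2] = ![(mv M p).1, (mv M p).2] := by
  ext i; fin_cases i <;> simp [mv, Matrix.mulVec, dotProduct, Fin.sum_univ_two]

theorem subst2_lin (M : Matrix (Fin 2) (Fin 2) ℂ) (v : ℂ × ℂ) :
    subst2 M (lin v) = lin (v.1 * M 0 0 + v.2 * M 1 0, v.1 * M 0 1 + v.2 * M 1 1) := by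
  simp only [lin, subst2_add, subst2_mul, subst2_C, subst2_X, C_add, C_mul]; ring

theorem lin_smul (t : ℂ) (v : ℂ × ℂ) : lin (t * v.1, t * v.2) = C t * lin v := by
  simp only [lin, C_mul]; ring

theorem subst2_linp (M : Matrix (Fin 2) (Fin 2) ℂ) (p : ℂ × ℂ) :
    subst2 M (lin (-(mv M p).2, (mv M p).1)) = C M.det * lin (-p.2, p.1) := by
  rw [subst2_lin, ← lin_smul]
  congr 1
  simp only [mv, Matrix.det_fin_two]
  ext <;> simp <;> ring

theorem isUnit_C' {t : ℂ} (h : t ≠ 0) : IsUnit (C t : MvPolynomial (Fin 2) ℂ) :=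
  (isUnit_iff_ne_zero.2 h).map C

theorem C_mul_dvd {t : ℂ} (h : t ≠ 0) (P Q : MvPolynomial (Fin 2) ℂ) : C t * P ∣ Q ↔ P ∣ Q :=
  (isUnit_C' h).mul_left_dvd
theorem dvd_C_mul {t : ℂ} (h : t ≠ 0) (P Q : MvPolynomial (Fin 2) ℂ) : P ∣ C t * Q ↔ P ∣ Q :=
  (isUnit_C' h).dvd_mul_left

section conj
variable {A B A' B' : MvPolynomial (Fin 2) ℂ} {M : Matrix (Fin 2) (Fin 2) ℂ} {c : ℂ}

def ConjM (A B A' B' : MvPolynomial (Fin 2) ℂ) (M : Matrix (Fin 2) (Fin 2) ℂ) (c : ℂ) : Prop :=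
  IsUnit M.det ∧ c ≠ 0 ∧
    C (M 0 0) * subst2 M A + C (M 1 0) * subst2 M B = C c * A' ∧
    C (M 0 1) * subst2 M A + C (M 1 1) * subst2 M B = C c * B'

theorem conj_D (h : ConjM A B A' B' M c) :
    C (c ^ 2) * Dpoly A' B' = C (M.det ^ 2) * subst2 M (Dpoly A B) := by
  obtain ⟨hd, hc, h1, h2⟩ := h
  have e1 : ∀ j, C c * pderiv j A' = pderiv j (C c * A') := by intro j; simp
  have e2 : ∀ j, C c * pderiv j B' = pderiv j (C c * B') := by intro j; simp
  have : C (c ^ 2) * Dpoly A' B' = (C c * pderiv 0 A') * (C c * pderiv 1 B')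
      - (C c * pderiv 1 A') * (C c * pderiv 0 B') := by
    simp only [Dpoly, C_pow]; ring
  rw [this, e1, e2, e1, e2, ← h1, ← h2]
  simp only [map_add, pderiv_subst2, Dpoly, subst2_sub, subst2_mul, Matrix.det_fin_two,
    C_pow, C_sub, C_mul, Derivation.leibniz, pderiv_C, smul_eq_mul]
  ring

theorem conj_cone (h : ConjM A B A' B' M c) :
    C c * cone A' B' = subst2 M (cone A B) := by
  obtain ⟨hd, hc, h1, h2⟩ := h
  have : C c * cone A' B' = X 0 * (C c * A') + X 1 * (C c * B') := by simp only [cone]; ring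
  rw [this, ← h1, ← h2]
  simp only [cone, subst2_add, subst2_mul, subst2_X]; ring

theorem conj_W (h : ConjM A B A' B' M c) :
    C c * (pderiv 0 B' - pderiv 1 A') = C M.det * subst2 M (pderiv 0 B - pderiv 1 A) := by
  obtain ⟨hd, hc, h1, h2⟩ := h
  have e1 : ∀ j, C c * pderiv j A' = pderiv j (C c * A') := by intro j; simp
  have e2 : ∀ j, C c * pderiv j B' = pderiv j (C c * B') := by intro j; simp
  rw [mul_sub, e1, e2, ← h1, ← h2]
  simp only [map_add, pderiv_subst2, subst2_sub, Matrix.det_fin_two,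
    C_sub, C_mul, Derivation.leibniz, pderiv_C, smul_eq_mul]
  ring

theorem conj_KK (h : ConjM A B A' B' M c) (n p) : KK A' B' n p ↔ KK A B n (mv M p) := by
  have hd : M.det ≠ 0 := h.1.ne_zero
  unfold KK
  rw [iff_comm, ← subst2_dvd M h.1, subst2_pow, subst2_linp, mul_pow, ← C_pow, C_mul_dvd (pow_ne_zero _ hd),
    iff_comm, ← dvd_C_mul (pow_ne_zero 2 h.2.1), conj_D h, dvd_C_mul (pow_ne_zero 2 hd)]

theorem conj_Fx (h : ConjM A B A' B' M c) (p) : Fx A' B' p ↔ Fx A B (mv M p) := by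
  have hd : M.det ≠ 0 := h.1.ne_zero
  unfold Fx
  rw [iff_comm, ← subst2_dvd M h.1, subst2_linp, C_mul_dvd hd, iff_comm, ← dvd_C_mul h.2.1, conj_cone h]

theorem conj_Wd (h : ConjM A B A' B' M c) (p) : Wd A' B' p ↔ Wd A B (mv M p) := by
  have hd : M.det ≠ 0 := h.1.ne_zero
  unfold Wd
  rw [iff_comm, ← subst2_dvd M h.1, subst2_linp, C_mul_dvd hd, iff_comm, ← dvd_C_mul h.2.1, conj_W h, dvd_C_mul hd]

theorem conj_evA (h : ConjM A B A' B' M c) (p : ℂ × ℂ) :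
    M 0 0 * eval ![(mv M p).1, (mv M p).2] A + M 1 0 * eval ![(mv M p).1, (mv M p).2] B
      = c * eval ![p.1, p.2] A' := by
  have := congrArg (eval ![p.1, p.2]) h.2.2.1
  simpa only [eval_subst2, mulVec_eq, map_add, map_mul, eval_C] using this

theorem conj_evB (h : ConjM A B A' B' M c) (p : ℂ × ℂ) :
    M 0 1 * eval ![(mv M p).1, (mv M p).2] A + M 1 1 * eval ![(mv M p).1, (mv M p).2] B
      = c * eval ![p.1, p.2] B' := by
  have := congrArg (eval ![p.1, p.2]) h.2.2.2
  simpa only [eval_subst2, mulVec_eq, map_add, map_mul, eval_C] using this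

theorem conj_Nx (h : ConjM A B A' B' M c) (p) : Nx A' B' p ↔ Nx A B (mv M p) := by
  unfold Nx
  rw [iff_comm, ← subst2_dvd M h.1, subst2_lin, ← conj_cone h, dvd_C_mul h.2.1, iff_comm, ← C_mul_dvd h.2.1, ← lin_smul]
  simp only
  rw [← conj_evA h, ← conj_evB h]
  ring_nf

theorem mv_ne (h : IsUnit M.det) (p : ℂ × ℂ) : p ≠ 0 ↔ mv M p ≠ 0 := by
  have hd : M.det ≠ 0 := h.ne_zero
  rw [Matrix.det_fin_two] at hd
  rw [not_iff_not]
  constructor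
  · rintro rfl; simp [mv]
  · intro hp
    simp only [mv, Prod.mk_eq_zero] at hp
    obtain ⟨h1, h2⟩ := hp
    apply Prod.ext
    · apply (mul_eq_zero.1 (?_ : (M 0 0 * M 1 1 - M 0 1 * M 1 0) * p.1 = 0)).resolve_left hd
      linear_combination M 1 1 * h1 - M 0 1 * h2
    · apply (mul_eq_zero.1 (?_ : (M 0 0 * M 1 1 - M 0 1 * M 1 0) * p.2 = 0)).resolve_left hd
      linear_combination M 0 0 * h2 - M 1 0 * h1

theorem mv_surj (h : IsUnit M.det) (q : ℂ × ℂ) : ∃ p, mv M p = q := by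
  have hd : M.det ≠ 0 := h.ne_zero
  rw [Matrix.det_fin_two] at hd
  refine ⟨((M 0 0 * M 1 1 - M 0 1 * M 1 0)⁻¹ * (M 1 1 * q.1 - M 0 1 * q.2),
    (M 0 0 * M 1 1 - M 0 1 * M 1 0)⁻¹ * (M 0 0 * q.2 - M 1 0 * q.1)), ?_⟩
  have := mul_inv_cancel₀ hd
  ext <;> simp only [mv]
  · linear_combination q.1 * this
  · linear_combination q.2 * this

theorem conj_flat (h : ConjM A B A' B' M c) : FlatP A' B' ↔ FlatP A B := by
  constructor
  · rintro ⟨h1, h2⟩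
    constructor
    · intro q hq
      obtain ⟨p, rfl⟩ := mv_surj h.1 q
      rw [← conj_KK h, ← conj_KK h, ← conj_Fx h, ← conj_Nx h]
      exact h1 p ((mv_ne h.1 p).2 hq)
    · intro q hq
      obtain ⟨p, rfl⟩ := mv_surj h.1 q
      rw [← conj_KK h, ← conj_KK h, ← conj_Fx h, ← conj_Wd h]
      exact h2 p ((mv_ne h.1 p).2 hq)
  · rintro ⟨h1, h2⟩
    constructor
    · intro p hp
      rw [conj_KK h, conj_KK h, conj_Fx h, conj_Nx h]
      exact h1 _ ((mv_ne h.1 p).1 hp)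
    · intro p hp
      rw [conj_KK h, conj_KK h, conj_Fx h, conj_Wd h]
      exact h2 _ ((mv_ne h.1 p).1 hp)
end conj

theorem hom_eval {n : ℕ} {P : MvPolynomial (Fin 2) ℂ} (hP : P.IsHomogeneous n) (t x y : ℂ) :
    eval ![t * x, t * y] P = t ^ n * eval ![x, y] P := by
  rw [eval_eq', eval_eq', Finset.mul_sum]
  refine Finset.sum_congr rfl fun d hd => ?_
  have h1 := hP.degree_eq_sum_deg_support hd
  rw [Finset.sum_subset (Finset.subset_univ d.support) (fun i _ h => by simpa using h),
    Fin.sum_univ_two] at h1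
  simp only [Fin.prod_univ_two, Matrix.cons_val_zero, Matrix.cons_val_one]
  rw [h1, pow_add, mul_pow, mul_pow]; ring

theorem dvd_aeval_sub (l : MvPolynomial (Fin 2) ℂ) (u w : Fin 2 → MvPolynomial (Fin 2) ℂ)
    (h : ∀ i, l ∣ u i - w i) (P : MvPolynomial (Fin 2) ℂ) : l ∣ aeval u P - aeval w P := by
  induction P using MvPolynomial.induction_on with
  | C a => simp
  | add p q hp hq =>
    have := dvd_add hp hq
    simp only [map_add]; convert this using 1; ring
  | mul_X p i hp =>
    simp only [map_mul, aeval_X]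
    have := dvd_add (hp.mul_right (u i)) ((h i).mul_left (aeval w p))
    convert this using 1; ring

theorem eval_vec (v : Fin 2 → ℂ) : v = ![v 0, v 1] := by
  ext i; fin_cases i <;> rfl

theorem eval_aeval' (u : Fin 2 → MvPolynomial (Fin 2) ℂ) (P : MvPolynomial (Fin 2) ℂ)
    (v : Fin 2 → ℂ) : eval v (aeval u P) = eval ![eval v (u 0), eval v (u 1)] P := by
  induction P using MvPolynomial.induction_on with
  | C a => simp
  | add p q hp hq => simp only [map_add, hp, hq]
  | mul_X p i hp =>
    simp only [map_mul, aeval_X, hp, eval_X]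
    fin_cases i <;> simp

theorem lin_dvd_iff {n : ℕ} {P : MvPolynomial (Fin 2) ℂ} (hP : P.IsHomogeneous n) (p : ℂ × ℂ)
    (hp : p ≠ 0) : lin (-p.2, p.1) ∣ P ↔ eval ![p.1, p.2] P = 0 := by
  constructor
  · rintro ⟨Q, rfl⟩
    simp [lin]; left; ring
  · intro h
    by_cases h1 : p.1 = 0
    · have h2 : p.2 ≠ 0 := fun h2 => hp (Prod.ext h1 h2)
      have := dvd_aeval_sub (lin (-p.2, p.1)) ![C p.2 * X 0, C p.2 * X 1] ![C p.1 * X 1, C p.2 * X 1]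
        (by
          intro i; fin_cases i
          · exact ⟨-1, by simp [lin]; ring⟩
          · simp) P
      have e1 : aeval ![C p.2 * X 0, C p.2 * X 1] P = C (p.2 ^ n) * P := by
        apply MvPolynomial.funext; intro v
        rw [eval_aeval']; simp only [Matrix.cons_val_zero, Matrix.cons_val_one, map_mul, eval_C, eval_X]
        rw [hom_eval hP, ← eval_vec v]
      have e2 : aeval ![C p.1 * X 1, C p.2 * X 1] P = (0 : MvPolynomial (Fin 2) ℂ) := by
        apply MvPolynomial.funext; intro v
        rw [eval_aeval']; simp only [Matrix.cons_val_zero, Matrix.cons_val_one, map_mul, eval_C, eval_X]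
        rw [mul_comm, mul_comm p.2, hom_eval hP, h]; simp
      rw [e1, e2, sub_zero] at this
      exact (dvd_C_mul (pow_ne_zero _ h2) _ _).1 this
    · have := dvd_aeval_sub (lin (-p.2, p.1)) ![C p.1 * X 0, C p.1 * X 1] ![C p.1 * X 0, C p.2 * X 0]
        (by
          intro i; fin_cases i
          · simp
          · exact ⟨1, by simp [lin]; ring⟩) P
      have e1 : aeval ![C p.1 * X 0, C p.1 * X 1] P = C (p.1 ^ n) * P := by
        apply MvPolynomial.funext; intro v
        rw [eval_aeval']; simp only [Matrix.cons_val_zero, Matrix.cons_val_one, map_mul, eval_C, eval_X]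
        rw [hom_eval hP, ← eval_vec v]
      have e2 : aeval ![C p.1 * X 0, C p.2 * X 0] P = (0 : MvPolynomial (Fin 2) ℂ) := by
        apply MvPolynomial.funext; intro v
        rw [eval_aeval']; simp only [Matrix.cons_val_zero, Matrix.cons_val_one, map_mul, eval_C, eval_X]
        rw [mul_comm, mul_comm p.2, hom_eval hP, h]; simp
      rw [e1, e2, sub_zero] at this
      exact (dvd_C_mul (pow_ne_zero _ h1) _ _).1 this

theorem lin_pow_dvd_pderiv (l P : MvPolynomial (Fin 2) ℂ) (k : ℕ) (i : Fin 2)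
    (h : l ^ (k + 1) ∣ P) : l ^ k ∣ pderiv i P := by
  obtain ⟨Q, rfl⟩ := h
  rw [Derivation.leibniz, Derivation.leibniz_pow]
  simp only [smul_eq_mul, nsmul_eq_mul, Nat.add_sub_cancel]
  exact ⟨l * pderiv i Q + Q * ((k + 1 : ℕ) : MvPolynomial (Fin 2) ℂ) * pderiv i l, by ring⟩

theorem lin_sq_dvd_iff {n : ℕ} {P : MvPolynomial (Fin 2) ℂ} (hP : P.IsHomogeneous (n + 1)) (p : ℂ × ℂ)
    (hp : p ≠ 0) : lin (-p.2, p.1) ^ 2 ∣ P ↔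
      eval ![p.1, p.2] (pderiv 0 P) = 0 ∧ eval ![p.1, p.2] (pderiv 1 P) = 0 := by
  have h0 : (pderiv 0 P).IsHomogeneous n := hP.pderiv
  have h1 : (pderiv 1 P).IsHomogeneous n := hP.pderiv
  rw [← lin_dvd_iff h0 p hp, ← lin_dvd_iff h1 p hp]
  constructor
  · intro h
    have a := lin_pow_dvd_pderiv _ P 1 0 h
    have b := lin_pow_dvd_pderiv _ P 1 1 h
    rw [pow_one] at a b
    exact ⟨a, b⟩
  · rintro ⟨⟨Q0, e0⟩, ⟨Q1, e1⟩⟩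
    have eu := hP.sum_X_mul_pderiv
    rw [Fin.sum_univ_two, e0, e1, nsmul_eq_mul] at eu
    have hn : ((n + 1 : ℕ) : ℂ) ≠ 0 := by exact_mod_cast Nat.succ_ne_zero n
    have hC : ((n + 1 : ℕ) : MvPolynomial (Fin 2) ℂ) = C ((n + 1 : ℕ) : ℂ) := by simp
    rw [hC] at eu
    set l := lin (-p.2, p.1) with hl
    obtain ⟨R, hR⟩ : l ∣ P := (dvd_C_mul hn _ _).1 ⟨X 0 * Q0 + X 1 * Q1, by rw [← eu]; ring⟩
    have l0 : pderiv 0 l = C (-p.2) := by simp [hl, lin, Derivation.leibniz, pderiv_X]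
    have l1 : pderiv 1 l = C p.1 := by simp [hl, lin, Derivation.leibniz, pderiv_X]
    have r : l ∣ R := by
      by_cases hz : p.1 = 0
      · have h2 : -p.2 ≠ 0 := fun h2 => hp (Prod.ext hz (by simpa using h2))
        apply (dvd_C_mul h2 _ _).1
        refine ⟨Q0 - pderiv 0 R, ?_⟩
        rw [mul_sub, ← e0, hR, Derivation.leibniz, l0]
        simp only [smul_eq_mul]; ring
      · apply (dvd_C_mul hz _ _).1
        refine ⟨Q1 - pderiv 1 R, ?_⟩
        rw [mul_sub, ← e1, hR, Derivation.leibniz, l1]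
        simp only [smul_eq_mul]; ring
    rw [hR, pow_two]
    exact mul_dvd_mul_left _ r

/-! ### Explicit cubic forms -/

def cub (a0 a1 a2 a3 : ℂ) : MvPolynomial (Fin 2) ℂ :=
  C a0 * X 0 ^ 3 + C a1 * X 0 ^ 2 * X 1 + C a2 * X 0 * X 1 ^ 2 + C a3 * X 1 ^ 3

theorem cub_hom (a0 a1 a2 a3 : ℂ) : (cub a0 a1 a2 a3).IsHomogeneous 3 := by
  unfold cub
  have h0 := isHomogeneous_X ℂ (0 : Fin 2)
  have h1 := isHomogeneous_X ℂ (1 : Fin 2)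
  refine (((((h0.pow 3).C_mul a0)).add ?_).add ?_).add ((h1.pow 3).C_mul a3)
  · exact ((h0.pow 2).C_mul a1).mul h1
  · exact ((h0).C_mul a2).mul (h1.pow 2)

theorem exists_cub {P : MvPolynomial (Fin 2) ℂ} (hP : P.IsHomogeneous 3) :
    ∃ a0 a1 a2 a3, P = cub a0 a1 a2 a3 := by
  rw [P.as_sum]
  refine Finset.sum_induction _ (fun Q => ∃ a0 a1 a2 a3, Q = cub a0 a1 a2 a3) ?_ ?_ ?_
  · rintro _ _ ⟨a, b, c, d, rfl⟩ ⟨a', b', c', d', rfl⟩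
    exact ⟨a + a', b + b', c + c', d + d', by simp only [cub, C_add]; ring⟩
  · exact ⟨0, 0, 0, 0, by simp [cub]⟩
  · intro d hd
    have h1 := hP.degree_eq_sum_deg_support hd
    rw [Finset.sum_subset (Finset.subset_univ d.support) (fun i _ h => by simpa using h),
    Fin.sum_univ_two] at h1
    rw [monomial_eq, Finsupp.prod_fintype _ _ (by simp), Fin.prod_univ_two]
    generalize coeff d P = r
    have h2 : d 0 ≤ 3 := by omega
    have h3 : d 1 = 3 - d 0 := by omega
    rw [h3]
    interval_cases d 0
    · exact ⟨0, 0, 0, r, by simp [cub]⟩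
    · exact ⟨0, 0, r, 0, by simp [cub]; ring⟩
    · exact ⟨0, r, 0, 0, by simp [cub]; ring⟩
    · exact ⟨r, 0, 0, 0, by simp [cub]⟩

theorem hom_D {A B : MvPolynomial (Fin 2) ℂ} (hA : A.IsHomogeneous 3) (hB : B.IsHomogeneous 3) :
    (Dpoly A B).IsHomogeneous 4 :=
  (hA.pderiv.mul hB.pderiv).sub (hA.pderiv.mul hB.pderiv)

theorem hom_cone {A B : MvPolynomial (Fin 2) ℂ} (hA : A.IsHomogeneous 3) (hB : B.IsHomogeneous 3) :
    (cone A B).IsHomogeneous 4 :=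
  ((isHomogeneous_X ℂ (0 : Fin 2)).mul hA).add ((isHomogeneous_X ℂ (1 : Fin 2)).mul hB)

theorem hom_W {A B : MvPolynomial (Fin 2) ℂ} (hA : A.IsHomogeneous 3) (hB : B.IsHomogeneous 3) :
    (pderiv 0 B - pderiv 1 A).IsHomogeneous 2 :=
  hB.pderiv.sub hA.pderiv

theorem C2' : (C 2 : MvPolynomial (Fin 2) ℂ) = 2 := map_ofNat C 2
theorem C3' : (C 3 : MvPolynomial (Fin 2) ℂ) = 3 := map_ofNat C 3
theorem C4' : (C 4 : MvPolynomial (Fin 2) ℂ) = 4 := map_ofNat C 4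

section evals
variable (a0 a1 a2 a3 b0 b1 b2 b3 x y : ℂ)

theorem ev_cub : eval ![x, y] (cub a0 a1 a2 a3) =
    a0 * x ^ 3 + a1 * x ^ 2 * y + a2 * x * y ^ 2 + a3 * y ^ 3 := by
  simp [cub]

theorem pd0_cub : pderiv 0 (cub a0 a1 a2 a3) =
    C (3 * a0) * X 0 ^ 2 + C (2 * a1) * X 0 * X 1 + C a2 * X 1 ^ 2 := by
  simp [cub, Derivation.leibniz, Derivation.leibniz_pow, pderiv_X, C2', C3', C4']; ring

theorem pd1_cub : pderiv 1 (cub a0 a1 a2 a3) =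
    C a1 * X 0 ^ 2 + C (2 * a2) * X 0 * X 1 + C (3 * a3) * X 1 ^ 2 := by
  simp [cub, Derivation.leibniz, Derivation.leibniz_pow, pderiv_X, C2', C3', C4']; ring

def qua (d0 d1 d2 d3 d4 : ℂ) : MvPolynomial (Fin 2) ℂ :=
  C d0 * X 0 ^ 4 + C d1 * X 0 ^ 3 * X 1 + C d2 * X 0 ^ 2 * X 1 ^ 2 + C d3 * X 0 * X 1 ^ 3
    + C d4 * X 1 ^ 4

theorem D_cub : Dpoly (cub a0 a1 a2 a3) (cub b0 b1 b2 b3) =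
    qua (3 * (a0 * b1 - a1 * b0)) (6 * (a0 * b2 - a2 * b0))
      (9 * (a0 * b3 - a3 * b0) + 3 * (a1 * b2 - a2 * b1)) (6 * (a1 * b3 - a3 * b1))
      (3 * (a2 * b3 - a3 * b2)) := by
  apply MvPolynomial.funext; intro v
  simp only [Dpoly, pd0_cub, pd1_cub, qua, map_add, map_sub, map_mul, map_pow, eval_C, eval_X]
  ring

variable (d0 d1 d2 d3 d4 : ℂ)
theorem ev_qua : eval ![x, y] (qua d0 d1 d2 d3 d4) =
    d0 * x ^ 4 + d1 * x ^ 3 * y + d2 * x ^ 2 * y ^ 2 + d3 * x * y ^ 3 + d4 * y ^ 4 := by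
  simp [qua]
theorem pd0_qua : pderiv 0 (qua d0 d1 d2 d3 d4) = cub (4 * d0) (3 * d1) (2 * d2) d3 := by
  simp [qua, cub, Derivation.leibniz, Derivation.leibniz_pow, pderiv_X, C2', C3', C4']; ring
theorem pd1_qua : pderiv 1 (qua d0 d1 d2 d3 d4) = cub d1 (2 * d2) (3 * d3) (4 * d4) := by
  simp [qua, cub, Derivation.leibniz, Derivation.leibniz_pow, pderiv_X, C2', C3', C4']; ring

theorem ev_cone : eval ![x, y] (cone (cub a0 a1 a2 a3) (cub b0 b1 b2 b3)) =
    x * (a0 * x ^ 3 + a1 * x ^ 2 * y + a2 * x * y ^ 2 + a3 * y ^ 3) +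
    y * (b0 * x ^ 3 + b1 * x ^ 2 * y + b2 * x * y ^ 2 + b3 * y ^ 3) := by
  simp [cone, ev_cub]

end evals

/-! ### Elementary versions -/

structure Co where
  a0 : ℂ
  a1 : ℂ
  a2 : ℂ
  a3 : ℂ
  b0 : ℂ
  b1 : ℂ
  b2 : ℂ
  b3 : ℂ

namespace Co
variable (c : Co) (x y : ℂ)
def PA : MvPolynomial (Fin 2) ℂ := cub c.a0 c.a1 c.a2 c.a3
def PB : MvPolynomial (Fin 2) ℂ := cub c.b0 c.b1 c.b2 c.b3
def ea : ℂ := c.a0 * x ^ 3 + c.a1 * x ^ 2 * y + c.a2 * x * y ^ 2 + c.a3 * y ^ 3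
def eb : ℂ := c.b0 * x ^ 3 + c.b1 * x ^ 2 * y + c.b2 * x * y ^ 2 + c.b3 * y ^ 3
def d0 : ℂ := 3 * (c.a0 * c.b1 - c.a1 * c.b0)
def d1 : ℂ := 6 * (c.a0 * c.b2 - c.a2 * c.b0)
def d2 : ℂ := 9 * (c.a0 * c.b3 - c.a3 * c.b0) + 3 * (c.a1 * c.b2 - c.a2 * c.b1)
def d3 : ℂ := 6 * (c.a1 * c.b3 - c.a3 * c.b1)
def d4 : ℂ := 3 * (c.a2 * c.b3 - c.a3 * c.b2)
def dv : ℂ := c.d0 * x ^ 4 + c.d1 * x ^ 3 * y + c.d2 * x ^ 2 * y ^ 2 + c.d3 * x * y ^ 3 + c.d4 * y ^ 4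
def dx : ℂ := 4 * c.d0 * x ^ 3 + 3 * c.d1 * x ^ 2 * y + 2 * c.d2 * x * y ^ 2 + c.d3 * y ^ 3
def dy : ℂ := c.d1 * x ^ 3 + 2 * c.d2 * x ^ 2 * y + 3 * c.d3 * x * y ^ 2 + 4 * c.d4 * y ^ 3
def cn : ℂ := x * c.ea x y + y * c.eb x y
def wd : ℂ := (3 * c.b0 - c.a1) * x ^ 2 + (2 * c.b1 - 2 * c.a2) * x * y + (c.b2 - 3 * c.a3) * y ^ 2

theorem D_eq : Dpoly c.PA c.PB = qua c.d0 c.d1 c.d2 c.d3 c.d4 := D_cub _ _ _ _ _ _ _ _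

variable {c x y}
theorem ne_pt (h : x ≠ 0 ∨ y ≠ 0) : ((x, y) : ℂ × ℂ) ≠ 0 := by
  intro h'; simp only [Prod.mk_eq_zero] at h'; tauto

theorem k1_iff (h : x ≠ 0 ∨ y ≠ 0) : KK c.PA c.PB 1 (x, y) ↔ c.dv x y = 0 := by
  have hD := hom_D (cub_hom c.a0 c.a1 c.a2 c.a3) (cub_hom c.b0 c.b1 c.b2 c.b3)
  have := lin_dvd_iff hD (x, y) (ne_pt h)
  unfold KK
  rw [pow_one]
  refine Iff.trans this ?_
  have e := c.D_eq
  rw [PA, PB] at e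
  rw [e, ev_qua, dv]

theorem k2_iff (h : x ≠ 0 ∨ y ≠ 0) : KK c.PA c.PB 2 (x, y) ↔ c.dx x y = 0 ∧ c.dy x y = 0 := by
  have hD := hom_D (cub_hom c.a0 c.a1 c.a2 c.a3) (cub_hom c.b0 c.b1 c.b2 c.b3)
  have := lin_sq_dvd_iff hD (x, y) (ne_pt h)
  unfold KK
  refine Iff.trans this ?_
  have e := c.D_eq
  rw [PA, PB] at e
  rw [e, pd0_qua, pd1_qua, ev_cub, ev_cub, dx, dy]

theorem k3_imp (h : KK c.PA c.PB 3 (x, y)) :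
    6 * c.d0 * x ^ 2 + 3 * c.d1 * x * y + c.d2 * y ^ 2 = 0 ∧
    c.d2 * x ^ 2 + 3 * c.d3 * x * y + 6 * c.d4 * y ^ 2 = 0 := by
  unfold KK at h
  rw [D_eq] at h
  have h1 := lin_pow_dvd_pderiv _ _ 1 0 (lin_pow_dvd_pderiv _ _ 2 0 h)
  have h2 := lin_pow_dvd_pderiv _ _ 1 1 (lin_pow_dvd_pderiv _ _ 2 1 h)
  rw [pow_one] at h1 h2
  rw [pd0_qua, pd0_cub] at h1
  rw [pd1_qua, pd1_cub] at h2
  obtain ⟨Q, h1⟩ := h1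
  obtain ⟨R, h2⟩ := h2
  have h1 := congrArg (eval ![x, y]) h1
  have h2 := congrArg (eval ![x, y]) h2
  simp [lin] at h1 h2
  constructor
  · linear_combination h1 / 2
  · linear_combination h2 / 2

theorem fx_iff (h : x ≠ 0 ∨ y ≠ 0) : Fx c.PA c.PB (x, y) ↔ c.cn x y = 0 := by
  have hD := hom_cone (cub_hom c.a0 c.a1 c.a2 c.a3) (cub_hom c.b0 c.b1 c.b2 c.b3)
  have := lin_dvd_iff hD (x, y) (ne_pt h)
  refine Iff.trans this ?_
  rw [ev_cone, cn, ea, eb]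

theorem wd_iff (h : x ≠ 0 ∨ y ≠ 0) : Wd c.PA c.PB (x, y) ↔ c.wd x y = 0 := by
  have hD := hom_W (cub_hom c.a0 c.a1 c.a2 c.a3) (cub_hom c.b0 c.b1 c.b2 c.b3)
  have := lin_dvd_iff hD (x, y) (ne_pt h)
  refine Iff.trans this ?_
  rw [pd0_cub, pd1_cub, wd]
  simp only [map_sub, map_add, map_mul, map_pow, eval_C, eval_X, Matrix.cons_val_zero, Matrix.cons_val_one]
  constructor <;> intro h <;> linear_combination h

theorem ev_PA : eval ![x, y] c.PA = c.ea x y := ev_cub _ _ _ _ _ _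
theorem ev_PB : eval ![x, y] c.PB = c.eb x y := ev_cub _ _ _ _ _ _

theorem nx_iff (h : c.eb x y ≠ 0 ∨ -c.ea x y ≠ 0) :
    Nx c.PA c.PB (x, y) ↔ c.cn (c.eb x y) (-c.ea x y) = 0 := by
  have := fx_iff (c := c) h
  rw [← this]
  unfold Nx Fx
  simp [ev_PA, ev_PB]

def EFlat (c : Co) : Prop :=
  (∀ x y, (x ≠ 0 ∨ y ≠ 0) → c.dv x y = 0 → ¬ (c.dx x y = 0 ∧ c.dy x y = 0) → c.cn x y ≠ 0 →
    c.cn (c.eb x y) (-c.ea x y) = 0) ∧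
  (∀ x y, (x ≠ 0 ∨ y ≠ 0) → c.dx x y = 0 → c.dy x y = 0 → c.cn x y ≠ 0 → c.wd x y = 0)

theorem ne_F (h : c.cn x y ≠ 0) : c.eb x y ≠ 0 ∨ -c.ea x y ≠ 0 := by
  by_contra h'
  push Not at h'
  apply h
  rw [cn, h'.1, neg_eq_zero.1 h'.2]; ring

theorem flat_of_eflat (h : c.EFlat) : FlatP c.PA c.PB := by
  obtain ⟨h1, h2⟩ := h
  constructor
  · rintro ⟨x, y⟩ hp k1 k2 f
    have hp' : x ≠ 0 ∨ y ≠ 0 := by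
      by_contra h'; push Not at h'; exact hp (by simp [h'.1, h'.2])
    rw [k1_iff hp'] at k1
    rw [k2_iff hp'] at k2
    rw [fx_iff hp'] at f
    rw [nx_iff (ne_F f)]
    exact h1 x y hp' k1 k2 f
  · rintro ⟨x, y⟩ hp k1 k2 f
    have hp' : x ≠ 0 ∨ y ≠ 0 := by
      by_contra h'; push Not at h'; exact hp (by simp [h'.1, h'.2])
    rw [k2_iff hp'] at k1
    rw [fx_iff hp'] at f
    rw [wd_iff hp']
    exact h2 x y hp' k1.1 k1.2 f

end Co

/-! ### Signatures -/

def TDF (A B : MvPolynomial (Fin 2) ℂ) : Prop := ∃ p : ℂ × ℂ, p ≠ 0 ∧ KK A B 2 p ∧ Fx A B p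
def TDN (A B : MvPolynomial (Fin 2) ℂ) : Prop := ∃ p : ℂ × ℂ, p ≠ 0 ∧ KK A B 2 p ∧ ¬ Fx A B p
def TSF (A B : MvPolynomial (Fin 2) ℂ) : Prop :=
  ∃ p : ℂ × ℂ, p ≠ 0 ∧ KK A B 1 p ∧ ¬ KK A B 2 p ∧ Fx A B p
def TSN (A B : MvPolynomial (Fin 2) ℂ) : Prop :=
  ∃ p : ℂ × ℂ, p ≠ 0 ∧ KK A B 1 p ∧ ¬ KK A B 2 p ∧ ¬ Fx A B p
def TTN (A B : MvPolynomial (Fin 2) ℂ) : Prop :=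
  ∃ p q : ℂ × ℂ, p.1 * q.2 - p.2 * q.1 ≠ 0 ∧
    (KK A B 1 p ∧ ¬ KK A B 2 p ∧ ¬ Fx A B p) ∧ (KK A B 1 q ∧ ¬ KK A B 2 q ∧ ¬ Fx A B q)

section conj
variable {A B A' B' : MvPolynomial (Fin 2) ℂ} {M : Matrix (Fin 2) (Fin 2) ℂ} {c : ℂ}

theorem ex_mv (h : IsUnit M.det) (Q Q' : ℂ × ℂ → Prop) (hq : ∀ p, Q' p ↔ Q (mv M p)) :
    (∃ p, p ≠ 0 ∧ Q' p) ↔ ∃ p, p ≠ 0 ∧ Q p := by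
  constructor
  · rintro ⟨p, hp, h1⟩
    exact ⟨mv M p, (mv_ne h p).1 hp, (hq p).1 h1⟩
  · rintro ⟨q, hq', h1⟩
    obtain ⟨p, rfl⟩ := mv_surj h q
    exact ⟨p, (mv_ne h p).2 hq', (hq p).2 h1⟩

theorem conj_TDF (h : ConjM A B A' B' M c) : TDF A' B' ↔ TDF A B :=
  ex_mv h.1 _ _ fun p => by rw [conj_KK h, conj_Fx h]
theorem conj_TDN (h : ConjM A B A' B' M c) : TDN A' B' ↔ TDN A B :=
  ex_mv h.1 _ _ fun p => by rw [conj_KK h, conj_Fx h]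
theorem conj_TSF (h : ConjM A B A' B' M c) : TSF A' B' ↔ TSF A B :=
  ex_mv h.1 _ _ fun p => by rw [conj_KK h, conj_KK h, conj_Fx h]
theorem conj_TSN (h : ConjM A B A' B' M c) : TSN A' B' ↔ TSN A B :=
  ex_mv h.1 _ _ fun p => by rw [conj_KK h, conj_KK h, conj_Fx h]

theorem mv_wedge (p q : ℂ × ℂ) : (mv M p).1 * (mv M q).2 - (mv M p).2 * (mv M q).1 =
    M.det * (p.1 * q.2 - p.2 * q.1) := by
  simp only [mv, Matrix.det_fin_two]; ring

theorem conj_TTN (h : ConjM A B A' B' M c) : TTN A' B' ↔ TTN A B := by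
  constructor
  · rintro ⟨p, q, h1, h2⟩
    rw [conj_KK h, conj_KK h, conj_Fx h, conj_KK h, conj_KK h, conj_Fx h] at h2
    refine ⟨mv M p, mv M q, ?_, h2⟩
    rw [mv_wedge]; exact mul_ne_zero h.1.ne_zero h1
  · rintro ⟨p, q, h1, h2⟩
    obtain ⟨p, rfl⟩ := mv_surj h.1 p
    obtain ⟨q, rfl⟩ := mv_surj h.1 q
    refine ⟨p, q, ?_, ?_⟩
    · rw [mv_wedge] at h1; exact right_ne_zero_of_mul h1
    · rw [conj_KK h, conj_KK h, conj_Fx h, conj_KK h, conj_KK h, conj_Fx h]; exact h2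
end conj

namespace Co
variable {c : Co}
theorem ex_pt (Q : ℂ × ℂ → Prop) (R : ℂ → ℂ → Prop) (h : ∀ x y, (x ≠ 0 ∨ y ≠ 0) → (Q (x, y) ↔ R x y)) :
    (∃ p, p ≠ 0 ∧ Q p) ↔ ∃ x y, (x ≠ 0 ∨ y ≠ 0) ∧ R x y := by
  constructor
  · rintro ⟨⟨x, y⟩, hp, hq⟩
    have hp' : x ≠ 0 ∨ y ≠ 0 := by
      by_contra h'; push Not at h'; exact hp (by simp [h'.1, h'.2])
    exact ⟨x, y, hp', (h x y hp').1 hq⟩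
  · rintro ⟨x, y, hp, hq⟩
    exact ⟨(x, y), ne_pt hp, (h x y hp).2 hq⟩

theorem tdf_iff : TDF c.PA c.PB ↔
    ∃ x y, (x ≠ 0 ∨ y ≠ 0) ∧ (c.dx x y = 0 ∧ c.dy x y = 0) ∧ c.cn x y = 0 :=
  ex_pt _ _ fun x y h => by rw [k2_iff h, fx_iff h]
theorem tdn_iff : TDN c.PA c.PB ↔
    ∃ x y, (x ≠ 0 ∨ y ≠ 0) ∧ (c.dx x y = 0 ∧ c.dy x y = 0) ∧ ¬ c.cn x y = 0 :=
  ex_pt _ _ fun x y h => by rw [k2_iff h, fx_iff h]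
theorem tsf_iff : TSF c.PA c.PB ↔
    ∃ x y, (x ≠ 0 ∨ y ≠ 0) ∧ c.dv x y = 0 ∧ ¬ (c.dx x y = 0 ∧ c.dy x y = 0) ∧ c.cn x y = 0 :=
  ex_pt _ _ fun x y h => by rw [k1_iff h, k2_iff h, fx_iff h]
theorem tsn_iff : TSN c.PA c.PB ↔
    ∃ x y, (x ≠ 0 ∨ y ≠ 0) ∧ c.dv x y = 0 ∧ ¬ (c.dx x y = 0 ∧ c.dy x y = 0) ∧ ¬ c.cn x y = 0 :=
  ex_pt _ _ fun x y h => by rw [k1_iff h, k2_iff h, fx_iff h]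
theorem ttn_iff : TTN c.PA c.PB ↔
    ∃ x y z w, x * w - y * z ≠ 0 ∧
      (c.dv x y = 0 ∧ ¬ (c.dx x y = 0 ∧ c.dy x y = 0) ∧ ¬ c.cn x y = 0) ∧
      (c.dv z w = 0 ∧ ¬ (c.dx z w = 0 ∧ c.dy z w = 0) ∧ ¬ c.cn z w = 0) := by
  have key : ∀ x y z w : ℂ, x * w - y * z ≠ 0 → (x ≠ 0 ∨ y ≠ 0) ∧ (z ≠ 0 ∨ w ≠ 0) := by
    intro x y z w h
    constructor
    · by_contra h'; push Not at h'; apply h; rw [h'.1, h'.2]; ring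
    · by_contra h'; push Not at h'; apply h; rw [h'.1, h'.2]; ring
  constructor
  · rintro ⟨⟨x, y⟩, ⟨z, w⟩, h, h1, h2⟩
    obtain ⟨n1, n2⟩ := key _ _ _ _ h
    rw [k1_iff n1, k2_iff n1, fx_iff n1] at h1
    rw [k1_iff n2, k2_iff n2, fx_iff n2] at h2
    exact ⟨x, y, z, w, h, h1, h2⟩
  · rintro ⟨x, y, z, w, h, h1, h2⟩
    obtain ⟨n1, n2⟩ := key _ _ _ _ h
    rw [← k1_iff n1, ← k2_iff n1, ← fx_iff n1] at h1
    rw [← k1_iff n2, ← k2_iff n2, ← fx_iff n2] at h2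
    exact ⟨(x, y), (z, w), h, h1, h2⟩
end Co

theorem s3_sq : s3 ^ 2 = 3 := by
  unfold s3
  rw [← Complex.ofReal_pow, Real.sq_sqrt (by norm_num)]; norm_num

theorem s3_ne : s3 ≠ 0 := by
  intro h; have := s3_sq; rw [h] at this; norm_num at this

/-- `i√3` -/
def is3 : ℂ := Complex.I * s3

theorem is3_sq : is3 ^ 2 = -3 := by
  unfold is3; rw [mul_pow, s3_sq, Complex.I_sq]; ring

theorem is3_ne : is3 ≠ 0 := by
  intro h; have := is3_sq; rw [h] at this; norm_num at this

theorem C6' : (C 6 : MvPolynomial (Fin 2) ℂ) = 6 := map_ofNat C 6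

def om : Fin 11 → Co :=
  ![⟨0, 0, 0, 1, -1, 0, 0, 0⟩,
    ⟨1, 0, 0, 0, 0, 0, 0, -1⟩,
    ⟨0, 0, 3, 1, -1, -3, 0, 0⟩,
    ⟨0, 0, 3, 1, 1, 3, 0, 0⟩,
    ⟨0, 0, 0, 2, -2, 3, 0, 0⟩,
    ⟨4, -6, 0, 4, -2, 3, 0, 0⟩,
    ⟨0, 0, 0, 1, -1, 0, 3, 0⟩,
    ⟨1, 0, -3, 0, 0, 0, 0, -4⟩,
    ⟨0, 0, -3 + is3, 2, 1 + is3, -2 * is3, 0, 0⟩,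
    ⟨0, 0, 3, s3, -s3, 3, 0, 0⟩,
    ⟨3, 3 * s3, 3, s3, s3, 3, 3 * s3, 3⟩]

theorem om0 : om 0 = ⟨0, 0, 0, 1, -1, 0, 0, 0⟩ := rfl
theorem om1 : om 1 = ⟨1, 0, 0, 0, 0, 0, 0, -1⟩ := rfl
theorem om2 : om 2 = ⟨0, 0, 3, 1, -1, -3, 0, 0⟩ := rfl
theorem om3 : om 3 = ⟨0, 0, 3, 1, 1, 3, 0, 0⟩ := rfl
theorem om4 : om 4 = ⟨0, 0, 0, 2, -2, 3, 0, 0⟩ := rfl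
theorem om5 : om 5 = ⟨4, -6, 0, 4, -2, 3, 0, 0⟩ := rfl
theorem om6 : om 6 = ⟨0, 0, 0, 1, -1, 0, 3, 0⟩ := rfl
theorem om7 : om 7 = ⟨1, 0, -3, 0, 0, 0, 0, -4⟩ := rfl
theorem om8 : om 8 = ⟨0, 0, -3 + is3, 2, 1 + is3, -2 * is3, 0, 0⟩ := rfl
theorem om9 : om 9 = ⟨0, 0, 3, s3, -s3, 3, 0, 0⟩ := rfl
theorem om10 : om 10 = ⟨3, 3 * s3, 3, s3, s3, 3, 3 * s3, 3⟩ := rfl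

theorem om_eq (i : Fin 11) : omegaList i = ((om i).PA, (om i).PB) := by
  fin_cases i <;>
  simp [omegaList, om, Co.PA, Co.PB, cub, C2', C3', C4', C6', is3] <;> (try constructor) <;> ring

namespace Co

def dbl (c : Co) (r : ℂ × ℂ) : Prop := c.dx r.1 r.2 = 0 ∧ c.dy r.1 r.2 = 0

theorem prop_ex {x y u v : ℂ} (h : x ≠ 0 ∨ y ≠ 0) (h' : u ≠ 0 ∨ v ≠ 0) (e : x * v = y * u) :
    ∃ t, t ≠ 0 ∧ x = t * u ∧ y = t * v := by
  by_cases hu : u = 0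
  · have hv : v ≠ 0 := by tauto
    have hx : x = 0 := by
      rw [hu, mul_zero] at e; exact (mul_eq_zero.1 e).resolve_right hv
    have hy : y ≠ 0 := by tauto
    exact ⟨y / v, div_ne_zero hy hv, by rw [hx, hu, mul_zero], by field_simp⟩
  · have hx : x ≠ 0 := by
      rintro rfl
      rw [zero_mul] at e
      have := (mul_eq_zero.1 e.symm).resolve_right hu
      tauto
    exact ⟨x / u, div_ne_zero hx hu, by field_simp, by field_simp; rw [e]⟩

variable {c : Co}

theorem sc_dv (t u v : ℂ) (ht : t ≠ 0) : c.dv (t * u) (t * v) = 0 ↔ c.dv u v = 0 := by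
  have : c.dv (t * u) (t * v) = t ^ 4 * c.dv u v := by unfold dv; ring
  rw [this, mul_eq_zero]; simp [ht]
theorem sc_dx (t u v : ℂ) (ht : t ≠ 0) : c.dx (t * u) (t * v) = 0 ↔ c.dx u v = 0 := by
  have : c.dx (t * u) (t * v) = t ^ 3 * c.dx u v := by unfold dx; ring
  rw [this, mul_eq_zero]; simp [ht]
theorem sc_dy (t u v : ℂ) (ht : t ≠ 0) : c.dy (t * u) (t * v) = 0 ↔ c.dy u v = 0 := by
  have : c.dy (t * u) (t * v) = t ^ 3 * c.dy u v := by unfold dy; ring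
  rw [this, mul_eq_zero]; simp [ht]
theorem sc_cn (t u v : ℂ) (ht : t ≠ 0) : c.cn (t * u) (t * v) = 0 ↔ c.cn u v = 0 := by
  have : c.cn (t * u) (t * v) = t ^ 4 * c.cn u v := by unfold cn ea eb; ring
  rw [this, mul_eq_zero]; simp [ht]
theorem sc_wd (t u v : ℂ) (ht : t ≠ 0) : c.wd (t * u) (t * v) = 0 ↔ c.wd u v = 0 := by
  have : c.wd (t * u) (t * v) = t ^ 2 * c.wd u v := by unfold wd; ring
  rw [this, mul_eq_zero]; simp [ht]
theorem sc_F (t u v : ℂ) (ht : t ≠ 0) :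
    c.cn (c.eb (t * u) (t * v)) (-c.ea (t * u) (t * v)) = 0 ↔ c.cn (c.eb u v) (-c.ea u v) = 0 := by
  have e1 : c.eb (t * u) (t * v) = t ^ 3 * c.eb u v := by unfold eb; ring
  have e2 : -c.ea (t * u) (t * v) = t ^ 3 * (-c.ea u v) := by unfold ea; ring
  rw [e1, e2, sc_cn _ _ _ (pow_ne_zero 3 ht)]

theorem euler (x y : ℂ) : 4 * c.dv x y = x * c.dx x y + y * c.dy x y := by
  unfold dv dx dy; ring

theorem dv_of_dbl {x y : ℂ} (h : c.dx x y = 0 ∧ c.dy x y = 0) : c.dv x y = 0 := by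
  have := euler (c := c) x y
  rw [h.1, h.2] at this
  simpa using this

theorem sig (c : Co) (DF DN SF SN : List (ℂ × ℂ))
    (hDF : ∀ r ∈ DF, (r.1 ≠ 0 ∨ r.2 ≠ 0) ∧ c.dbl r ∧ c.cn r.1 r.2 = 0)
    (hDN : ∀ r ∈ DN, (r.1 ≠ 0 ∨ r.2 ≠ 0) ∧ c.dbl r ∧ c.cn r.1 r.2 ≠ 0 ∧ c.wd r.1 r.2 = 0)
    (hSF : ∀ r ∈ SF, (r.1 ≠ 0 ∨ r.2 ≠ 0) ∧ c.dv r.1 r.2 = 0 ∧ ¬ c.dbl r ∧ c.cn r.1 r.2 = 0)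
    (hSN : ∀ r ∈ SN, (r.1 ≠ 0 ∨ r.2 ≠ 0) ∧ c.dv r.1 r.2 = 0 ∧ ¬ c.dbl r ∧ c.cn r.1 r.2 ≠ 0 ∧
      c.cn (c.eb r.1 r.2) (-c.ea r.1 r.2) = 0)
    (cov : ∀ x y, c.dv x y = 0 → ∃ r ∈ DF ++ DN ++ SF ++ SN, x * r.2 = y * r.1) :
    c.EFlat ∧ (TDF c.PA c.PB ↔ DF ≠ []) ∧ (TDN c.PA c.PB ↔ DN ≠ []) ∧
      (TSF c.PA c.PB ↔ SF ≠ []) ∧ (TSN c.PA c.PB ↔ SN ≠ []) := by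
  have ne : ∀ l : List (ℂ × ℂ), l ≠ [] ↔ ∃ r, r ∈ l := by
    intro l; cases l <;> simp
  have cov' : ∀ x y, (x ≠ 0 ∨ y ≠ 0) → c.dv x y = 0 →
      ∃ r ∈ DF ++ DN ++ SF ++ SN, ∃ t, t ≠ 0 ∧ x = t * r.1 ∧ y = t * r.2 := by
    intro x y h h'
    obtain ⟨r, hr, e⟩ := cov x y h'
    refine ⟨r, hr, prop_ex h ?_ e⟩
    simp only [List.mem_append] at hr
    rcases hr with ((hr | hr) | hr) | hr
    · exact (hDF r hr).1
    · exact (hDN r hr).1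
    · exact (hSF r hr).1
    · exact (hSN r hr).1
  simp only [List.mem_append] at cov'
  unfold dbl at *
  refine ⟨⟨?_, ?_⟩, ?_, ?_, ?_, ?_⟩
  · intro x y h h1 h2 h3
    obtain ⟨r, hr, t, ht, rfl, rfl⟩ := cov' x y h h1
    rw [sc_dx _ _ _ ht, sc_dy _ _ _ ht] at h2
    rw [Ne, sc_cn _ _ _ ht] at h3
    rw [sc_F _ _ _ ht]
    rcases hr with ((hr | hr) | hr) | hr
    · exact absurd (hDF r hr).2.1 h2
    · exact absurd (hDN r hr).2.1 h2
    · exact absurd (hSF r hr).2.2.2 h3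
    · exact (hSN r hr).2.2.2.2
  · intro x y h h1 h2 h3
    obtain ⟨r, hr, t, ht, rfl, rfl⟩ := cov' x y h (dv_of_dbl ⟨h1, h2⟩)
    rw [sc_dx _ _ _ ht] at h1
    rw [sc_dy _ _ _ ht] at h2
    rw [Ne, sc_cn _ _ _ ht] at h3
    rw [sc_wd _ _ _ ht]
    rcases hr with ((hr | hr) | hr) | hr
    · exact absurd (hDF r hr).2.2 h3
    · exact (hDN r hr).2.2.2
    · exact absurd ⟨h1, h2⟩ (hSF r hr).2.2.1
    · exact absurd ⟨h1, h2⟩ (hSN r hr).2.2.1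
  · rw [tdf_iff, ne]
    constructor
    · rintro ⟨x, y, h, h2, h3⟩
      obtain ⟨r, hr, t, ht, rfl, rfl⟩ := cov' x y h (dv_of_dbl h2)
      rw [sc_dx _ _ _ ht, sc_dy _ _ _ ht] at h2
      rw [sc_cn _ _ _ ht] at h3
      rcases hr with ((hr | hr) | hr) | hr
      · exact ⟨r, hr⟩
      · exact absurd h3 (hDN r hr).2.2.1
      · exact absurd h2 (hSF r hr).2.2.1
      · exact absurd h2 (hSN r hr).2.2.1
    · rintro ⟨r, hr⟩
      exact ⟨r.1, r.2, (hDF r hr).1, (hDF r hr).2⟩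
  · rw [tdn_iff, ne]
    constructor
    · rintro ⟨x, y, h, h2, h3⟩
      obtain ⟨r, hr, t, ht, rfl, rfl⟩ := cov' x y h (dv_of_dbl h2)
      rw [sc_dx _ _ _ ht, sc_dy _ _ _ ht] at h2
      rw [sc_cn _ _ _ ht] at h3
      rcases hr with ((hr | hr) | hr) | hr
      · exact absurd (hDF r hr).2.2 h3
      · exact ⟨r, hr⟩
      · exact absurd h2 (hSF r hr).2.2.1
      · exact absurd h2 (hSN r hr).2.2.1
    · rintro ⟨r, hr⟩
      exact ⟨r.1, r.2, (hDN r hr).1, (hDN r hr).2.1, (hDN r hr).2.2.1⟩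
  · rw [tsf_iff, ne]
    constructor
    · rintro ⟨x, y, h, h1, h2, h3⟩
      obtain ⟨r, hr, t, ht, rfl, rfl⟩ := cov' x y h h1
      rw [sc_dx _ _ _ ht, sc_dy _ _ _ ht] at h2
      rw [sc_cn _ _ _ ht] at h3
      rcases hr with ((hr | hr) | hr) | hr
      · exact absurd (hDF r hr).2.1 h2
      · exact absurd (hDN r hr).2.1 h2
      · exact ⟨r, hr⟩
      · exact absurd h3 (hSN r hr).2.2.2.1
    · rintro ⟨r, hr⟩
      exact ⟨r.1, r.2, (hSF r hr).1, (hSF r hr).2⟩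
  · rw [tsn_iff, ne]
    constructor
    · rintro ⟨x, y, h, h1, h2, h3⟩
      obtain ⟨r, hr, t, ht, rfl, rfl⟩ := cov' x y h h1
      rw [sc_dx _ _ _ ht, sc_dy _ _ _ ht] at h2
      rw [sc_cn _ _ _ ht] at h3
      rcases hr with ((hr | hr) | hr) | hr
      · exact absurd (hDF r hr).2.1 h2
      · exact absurd (hDN r hr).2.1 h2
      · exact absurd (hSF r hr).2.2.2 h3
      · exact ⟨r, hr⟩
    · rintro ⟨r, hr⟩
      exact ⟨r.1, r.2, (hSN r hr).1, (hSN r hr).2.1, (hSN r hr).2.2.1, (hSN r hr).2.2.2.1⟩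

def Sg (i : Fin 11) (b1 b2 b3 b4 : Prop) : Prop :=
  (om i).EFlat ∧ (TDF (om i).PA (om i).PB ↔ b1) ∧ (TDN (om i).PA (om i).PB ↔ b2) ∧
      (TSF (om i).PA (om i).PB ↔ b3) ∧ (TSN (om i).PA (om i).PB ↔ b4)

theorem cov_aux {i : Fin 11} {k : ℂ} (f : ℂ → ℂ → ℂ) (hk : k ≠ 0)
    (h : ∀ x y, (om i).dv x y = k * f x y) {x y : ℂ} (h0 : (om i).dv x y = 0) : f x y = 0 := by
  rw [h] at h0; exact (mul_eq_zero.1 h0).resolve_left hk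

theorem sg0 : Sg 0 True False False False := by
  have := sig (om 0) [(1, 0), (0, 1)] [] [] [] ?_ ?_ ?_ ?_ ?_
  · simpa [Sg] using this
  · norm_num [om0, dbl, dv, dx, dy, d0, d1, d2, d3, d4, cn, ea, eb, wd]
  · simp
  · simp
  · simp
  · intro x y h
    have := cov_aux (k := 9) (fun x y => x ^ 2 * y ^ 2) (by norm_num) (by
      intro x y; norm_num [om0, dv, d0, d1, d2, d3, d4]; try ring) h
    simp at this ⊢; tauto

theorem sg1 : Sg 1 False True False False := by
  have := sig (om 1) [] [(1, 0), (0, 1)] [] [] ?_ ?_ ?_ ?_ ?_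
  · simpa [Sg] using this
  · simp
  · norm_num [om1, dbl, dv, dx, dy, d0, d1, d2, d3, d4, cn, ea, eb, wd]
  · simp
  · simp
  · intro x y h
    have := cov_aux (k := -9) (fun x y => x ^ 2 * y ^ 2) (by norm_num) (by
      intro x y; norm_num [om1, dv, d0, d1, d2, d3, d4]; try ring) h
    simp at this ⊢; tauto

theorem sg2 : Sg 2 True False True False := by
  have := sig (om 2) [(1, -1)] [] [(1, 0), (0, 1)] [] ?_ ?_ ?_ ?_ ?_
  · simpa [Sg] using this
  · norm_num [om2, dbl, dv, dx, dy, d0, d1, d2, d3, d4, cn, ea, eb, wd]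
  · simp
  · norm_num [om2, dbl, dv, dx, dy, d0, d1, d2, d3, d4, cn, ea, eb, wd]
  · simp
  · intro x y h
    have := cov_aux (k := 18) (fun x y => x * y * (x + y) ^ 2) (by norm_num) (by
      intro x y; norm_num [om2, dv, d0, d1, d2, d3, d4]; try ring) h
    simp at this ⊢; grind

theorem sg3 : Sg 3 False True True False := by
  have := sig (om 3) [] [(1, -1)] [(1, 0), (0, 1)] [] ?_ ?_ ?_ ?_ ?_
  · simpa [Sg] using this
  · simp
  · norm_num [om3, dbl, dv, dx, dy, d0, d1, d2, d3, d4, cn, ea, eb, wd]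
  · norm_num [om3, dbl, dv, dx, dy, d0, d1, d2, d3, d4, cn, ea, eb, wd]
  · simp
  · intro x y h
    have := cov_aux (k := -18) (fun x y => x * y * (x + y) ^ 2) (by norm_num) (by
      intro x y; norm_num [om3, dv, d0, d1, d2, d3, d4]; try ring) h
    simp at this ⊢; grind

theorem sg4 : Sg 4 True False True True := by
  have := sig (om 4) [(1, 0)] [] [(0, 1)] [(1, 1)] ?_ ?_ ?_ ?_ ?_
  · simpa [Sg] using this
  · norm_num [om4, dbl, dv, dx, dy, d0, d1, d2, d3, d4, cn, ea, eb, wd]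
  · simp
  · norm_num [om4, dbl, dv, dx, dy, d0, d1, d2, d3, d4, cn, ea, eb, wd]
  · norm_num [om4, dbl, dv, dx, dy, d0, d1, d2, d3, d4, cn, ea, eb, wd]
  · intro x y h
    have := cov_aux (k := 36) (fun x y => x * y ^ 2 * (x - y)) (by norm_num) (by
      intro x y; norm_num [om4, dv, d0, d1, d2, d3, d4]; try ring) h
    simp at this ⊢; grind

theorem sg5 : Sg 5 False True True True := by
  have := sig (om 5) [] [(1, 0)] [(0, 1)] [(1, 1)] ?_ ?_ ?_ ?_ ?_
  · simpa [Sg] using this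
  · simp
  · norm_num [om5, dbl, dv, dx, dy, d0, d1, d2, d3, d4, cn, ea, eb, wd]
  · norm_num [om5, dbl, dv, dx, dy, d0, d1, d2, d3, d4, cn, ea, eb, wd]
  · norm_num [om5, dbl, dv, dx, dy, d0, d1, d2, d3, d4, cn, ea, eb, wd]
  · intro x y h
    have := cov_aux (k := 72) (fun x y => x * y ^ 2 * (x - y)) (by norm_num) (by
      intro x y; norm_num [om5, dv, d0, d1, d2, d3, d4]; try ring) h
    simp at this ⊢; grind

theorem sg6 : Sg 6 True False False True := by
  have := sig (om 6) [(1, 0)] [] [] [(1, 1), (1, -1)] ?_ ?_ ?_ ?_ ?_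
  · simpa [Sg] using this
  · norm_num [om6, dbl, dv, dx, dy, d0, d1, d2, d3, d4, cn, ea, eb, wd]
  · simp
  · simp
  · norm_num [om6, dbl, dv, dx, dy, d0, d1, d2, d3, d4, cn, ea, eb, wd]
  · intro x y h
    have := cov_aux (k := 9) (fun x y => y ^ 2 * (x - y) * (x + y)) (by norm_num) (by
      intro x y; norm_num [om6, dv, d0, d1, d2, d3, d4]; try ring) h
    simp at this ⊢; grind

theorem sg7 : Sg 7 False True False True := by
  have := sig (om 7) [] [(1, 0)] [] [(1, 1), (1, -1)] ?_ ?_ ?_ ?_ ?_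
  · simpa [Sg] using this
  · simp
  · norm_num [om7, dbl, dv, dx, dy, d0, d1, d2, d3, d4, cn, ea, eb, wd]
  · simp
  · norm_num [om7, dbl, dv, dx, dy, d0, d1, d2, d3, d4, cn, ea, eb, wd]
  · intro x y h
    have := cov_aux (k := -36) (fun x y => y ^ 2 * (x - y) * (x + y)) (by norm_num) (by
      intro x y; norm_num [om7, dv, d0, d1, d2, d3, d4]; try ring) h
    simp at this ⊢; grind


theorem w_ne (a b : ℂ) (h : a ^ 2 + 3 * b ^ 2 ≠ 0) : a + b * is3 ≠ 0 := by
  intro h'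
  apply h
  linear_combination (a - b * is3) * h' + b ^ 2 * is3_sq

theorem sg8 : Sg 8 False False True True ∧ ¬ TTN (om 8).PA (om 8).PB := by
  have hw := is3_sq
  have cov : ∀ x y, (om 8).dv x y = 0 → x = 0 ∨ y = 0 ∨ x = y ∨ 2 * x = (1 + is3) * y := by
    intro x y h
    have e : (om 8).dv x y = (18 + 6 * is3) * (x * y * (x - y) * (2 * x - (1 + is3) * y)) := by
      simp only [om8, dv, d0, d1, d2, d3, d4]; grind
    rw [e] at h
    have := (mul_eq_zero.1 h).resolve_left (w_ne 18 6 (by norm_num))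
    simp only [mul_eq_zero, sub_eq_zero] at this
    tauto
  have eF : (om 8).cn 1 0 = 0 ∧ (om 8).cn 0 1 = 0 ∧ (om 8).cn 1 1 = 0 := by
    simp only [om8, cn, ea, eb]; grind
  constructor
  · have := sig (om 8) [] [] [(1, 0), (0, 1), (1, 1)] [(1 + is3, 2)] ?_ ?_ ?_ ?_ ?_
    · simpa [Sg] using this
    · simp
    · simp
    · have e1 : (om 8).dy 1 0 = 36 + 12 * is3 := by simp only [om8, dy, d1, d2, d3, d4]; grind
      have e2 : (om 8).dx 0 1 = 0 + 24 * is3 := by simp only [om8, dx, d0, d1, d2, d3, d4]; grind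
      have e3 : (om 8).dx 1 1 = 36 + (-12) * is3 := by simp only [om8, dx, d0, d1, d2, d3, d4]; grind
      have e4 : (om 8).dv 1 0 = 0 ∧ (om 8).dv 0 1 = 0 ∧ (om 8).dv 1 1 = 0 := by
        simp only [om8, dv, d0, d1, d2, d3, d4]; grind
      simp only [List.mem_cons, List.not_mem_nil, or_false, forall_eq_or_imp, forall_eq, dbl, e1, e2, e3]
      refine ⟨⟨by simp, e4.1, fun h => w_ne _ _ (by norm_num) h.2, eF.1⟩,
        ⟨by simp, e4.2.1, fun h => w_ne _ _ (by norm_num) h.1, eF.2.1⟩,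
        ⟨by simp, e4.2.2, fun h => w_ne _ _ (by norm_num) h.1, eF.2.2⟩⟩
    · have e1 : (om 8).dx (1 + is3) 2 = -288 + (-96) * is3 := by
        simp only [om8, dx, d0, d1, d2, d3, d4]; grind
      have e2 : (om 8).dv (1 + is3) 2 = 0 := by
        simp only [om8, dv, d0, d1, d2, d3, d4]; grind
      have e3 : (om 8).cn (1 + is3) 2 = 48 + (-16) * is3 := by
        simp only [om8, cn, ea, eb]; grind
      have e4 : (om 8).eb (1 + is3) 2 = 16 := by
        simp only [om8, eb]; grind
      have e5 : (om 8).ea (1 + is3) 2 = -8 * (1 + is3) := by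
        simp only [om8, ea]; grind
      simp only [List.mem_cons, List.not_mem_nil, or_false, forall_eq_or_imp, forall_eq, dbl, e1, e2, e3, e4, e5]
      refine ⟨by simp, trivial, fun h => w_ne _ _ (by norm_num) h.1, w_ne _ _ (by norm_num), ?_⟩
      simp only [om8, cn, ea, eb]; grind
    · intro x y h
      have := cov x y h
      simp; grind
  · rw [ttn_iff]
    have key : ∀ x y, (om 8).dv x y = 0 → ¬ (om 8).cn x y = 0 → 2 * x = (1 + is3) * y := by
      intro x y h h'
      rcases cov x y h with rfl | rfl | rfl | h
      · refine absurd ?_ h'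
        simp only [om8, cn, ea, eb]; ring
      · refine absurd ?_ h'
        simp only [om8, cn, ea, eb]; ring
      · refine absurd ?_ h'
        simp only [om8, cn, ea, eb]; ring
      · exact h
    rintro ⟨x, y, z, t, hn, ⟨h1, -, h2⟩, ⟨h3, -, h4⟩⟩
    have k1 := key x y h1 h2
    have k2 := key z t h3 h4
    apply hn
    linear_combination (t * k1 - y * k2) / 2

theorem sg9 : Sg 9 False False True True ∧ TTN (om 9).PA (om 9).PB := by
  have hw := s3_sq
  have hn := s3_ne
  have e1 : (om 9).dv 1 1 = 0 ∧ (om 9).dv 1 (-1) = 0 ∧ (om 9).dv 1 0 = 0 ∧ (om 9).dv 0 1 = 0 := by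
    simp only [om9, dv, d0, d1, d2, d3, d4]; grind
  have e2 : (om 9).dx 1 1 = 36 * s3 ∧ (om 9).dx 1 (-1) = -36 * s3 ∧ (om 9).dy 1 0 = 18 * s3 ∧
      (om 9).dx 0 1 = -18 * s3 := by
    simp only [om9, dx, dy, d0, d1, d2, d3, d4]; grind
  have e3 : (om 9).cn 1 1 = 6 ∧ (om 9).cn 1 (-1) = 6 ∧ (om 9).cn 1 0 = 0 ∧ (om 9).cn 0 1 = 0 := by
    simp only [om9, cn, ea, eb]; grind
  have e4 : (om 9).eb 1 1 = 3 - s3 ∧ (om 9).eb 1 (-1) = -3 - s3 ∧ (om 9).ea 1 1 = 3 + s3 ∧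
      (om 9).ea 1 (-1) = 3 - s3 := by
    simp only [om9, ea, eb]; grind
  constructor
  · have := sig (om 9) [] [] [(1, 0), (0, 1)] [(1, 1), (1, -1)] ?_ ?_ ?_ ?_ ?_
    · simpa [Sg] using this
    · simp
    · simp
    · simp only [List.mem_cons, List.not_mem_nil, or_false, forall_eq_or_imp, forall_eq, dbl]
      simp [e1, e2, e3, hn]
    · simp only [List.mem_cons, List.not_mem_nil, or_false, forall_eq_or_imp, forall_eq, dbl]
      simp only [e1, e2, e3, e4]
      refine ⟨⟨by simp, trivial, by simp [hn], by norm_num, ?_⟩, ⟨by simp, trivial, by simp [hn], by norm_num, ?_⟩⟩ <;>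
      · simp only [om9, cn, ea, eb]; grind
    · intro x y h
      have := cov_aux (k := 18 * s3) (fun x y => x * y * ((x - y) * (x + y))) (by simp [hn]) (by
        intro x y; simp only [om9, dv, d0, d1, d2, d3, d4]; grind) h
      simp at this ⊢; grind
  · rw [ttn_iff]
    refine ⟨1, 1, 1, -1, by norm_num, ?_, ?_⟩ <;> simp [e1, e2, e3, hn]

theorem sg10 : Sg 10 False False False True := by
  have hw := s3_sq
  have hn := s3_ne
  have hi := Complex.I_sq
  obtain ⟨p, hp⟩ : ∃ p, p = -(s3 + Complex.I) := ⟨_, rfl⟩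
  obtain ⟨q, hq⟩ : ∃ q, q = -(s3 - Complex.I) := ⟨_, rfl⟩
  have hz : is3 = Complex.I * s3 := rfl
  have e1 : (om 10).dv 1 0 = 0 ∧ (om 10).dv 0 1 = 0 ∧ (om 10).dv p 2 = 0 ∧ (om 10).dv q 2 = 0 := by
    simp only [om10, dv, d0, d1, d2, d3, d4]; grind
  have e2 : (om 10).dy 1 0 = 36 * s3 ∧ (om 10).dx 0 1 = 36 * s3 ∧
      (om 10).dx p 2 = -144 * s3 * (1 + (-1) * is3) ∧ (om 10).dx q 2 = -144 * s3 * (1 + 1 * is3) := by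
    simp only [om10, dx, dy, d0, d1, d2, d3, d4]; grind
  have e3 : (om 10).cn 1 0 = 3 ∧ (om 10).cn 0 1 = 3 ∧ (om 10).cn p 2 = -24 + (-24) * is3 ∧
      (om 10).cn q 2 = -24 + 24 * is3 := by
    simp only [om10, cn, ea, eb]; grind
  have e4 : (om 10).ea 1 0 = 3 ∧ (om 10).ea 0 1 = s3 ∧ (om 10).ea p 2 = 8 * s3 ∧
      (om 10).ea q 2 = 8 * s3 := by
    simp only [om10, ea]; grind
  have e5 : (om 10).eb 1 0 = s3 ∧ (om 10).eb 0 1 = 3 ∧ (om 10).eb p 2 = -8 * is3 ∧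
      (om 10).eb q 2 = 8 * is3 := by
    simp only [om10, eb]; grind
  have n1 : -144 * s3 * (1 + (-1) * is3) ≠ 0 :=
    mul_ne_zero (mul_ne_zero (by norm_num) hn) (w_ne _ _ (by norm_num))
  have n2 : -144 * s3 * (1 + 1 * is3) ≠ 0 :=
    mul_ne_zero (mul_ne_zero (by norm_num) hn) (w_ne _ _ (by norm_num))
  have n3 : 36 * s3 ≠ 0 := mul_ne_zero (by norm_num) hn
  have := sig (om 10) [] [] [] [(1, 0), (0, 1), (p, 2), (q, 2)] ?_ ?_ ?_ ?_ ?_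
  · simpa [Sg] using this
  · simp
  · simp
  · simp
  · simp only [List.mem_cons, List.not_mem_nil, or_false, forall_eq_or_imp, forall_eq, dbl]
    simp only [e1, e2, e3, e4, e5]
    refine ⟨⟨by simp, trivial, fun h => n3 h.2, by norm_num, ?_⟩,
      ⟨by simp, trivial, fun h => n3 h.1, by norm_num, ?_⟩,
      ⟨by simp, trivial, fun h => n1 h.1, w_ne _ _ (by norm_num), ?_⟩,
      ⟨by simp, trivial, fun h => n2 h.1, w_ne _ _ (by norm_num), ?_⟩⟩ <;>
    · simp only [om10, cn, ea, eb]; grind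
  · intro x y h
    have := cov_aux (k := 36 * s3) (fun x y => x * y * ((x - p / 2 * y) * (x - q / 2 * y))) n3 (by
      intro x y; simp only [om10, dv, d0, d1, d2, d3, d4]; grind) h
    simp only [mul_eq_zero, sub_eq_zero] at this
    rcases this with (h | h) | h | h
    · exact ⟨(0, 1), by simp, by simp [h]⟩
    · exact ⟨(1, 0), by simp, by simp [h]⟩
    · exact ⟨(p, 2), by simp, by simp only; linear_combination 2 * h⟩
    · exact ⟨(q, 2), by simp, by simp only; linear_combination 2 * h⟩

theorem om_flat (i : Fin 11) : (om i).EFlat := by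
  fin_cases i
  · exact sg0.1
  · exact sg1.1
  · exact sg2.1
  · exact sg3.1
  · exact sg4.1
  · exact sg5.1
  · exact sg6.1
  · exact sg7.1
  · exact sg8.1.1
  · exact sg9.1.1
  · exact sg10.1

theorem sg_ne {i j : Fin 11} {a b c d a' b' c' d' : Prop} (h : Sg i a b c d) (h' : Sg j a' b' c' d')
    (hn : ¬ ((a ↔ a') ∧ (b ↔ b') ∧ (c ↔ c') ∧ (d ↔ d'))) :
    ¬ LinConj2 (om i).PA (om i).PB (om j).PA (om j).PB := by
  rintro ⟨M, k, hM⟩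
  have hM : ConjM (om i).PA (om i).PB (om j).PA (om j).PB M k := hM
  have h1 := conj_TDF hM
  have h2 := conj_TDN hM
  have h3 := conj_TSF hM
  have h4 := conj_TSN hM
  obtain ⟨-, g1, g2, g3, g4⟩ := h
  obtain ⟨-, f1, f2, f3, f4⟩ := h'
  rw [g1, f1] at h1
  rw [g2, f2] at h2
  rw [g3, f3] at h3
  rw [g4, f4] at h4
  exact hn ⟨h1.symm, h2.symm, h3.symm, h4.symm⟩

theorem nonconj (i j : Fin 11) (hij : i ≠ j) :
    ¬ LinConj2 (om i).PA (om i).PB (om j).PA (om j).PB := by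
  have h89 : ∀ k l, ¬ ConjM (om 8).PA (om 8).PB (om 9).PA (om 9).PB k l := by
    intro k l h; exact sg8.2 ((conj_TTN h).1 sg9.2)
  have h98 : ∀ k l, ¬ ConjM (om 9).PA (om 9).PB (om 8).PA (om 8).PB k l := by
    intro k l h; exact sg8.2 ((conj_TTN h).2 sg9.2)
  by_cases h1 : i = 8 ∧ j = 9
  · obtain ⟨rfl, rfl⟩ := h1
    rintro ⟨M, k, h⟩; exact h89 M k h
  by_cases h2 : i = 9 ∧ j = 8
  · obtain ⟨rfl, rfl⟩ := h2
    rintro ⟨M, k, h⟩; exact h98 M k h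
  let S : Fin 11 → Bool × Bool × Bool × Bool :=
    ![(true, false, false, false), (false, true, false, false), (true, false, true, false),
      (false, true, true, false), (true, false, true, true), (false, true, true, true),
      (true, false, false, true), (false, true, false, true), (false, false, true, true),
      (false, false, true, true), (false, false, false, true)]
  have hS : ∀ i, Sg i ((S i).1 = true) ((S i).2.1 = true) ((S i).2.2.1 = true) ((S i).2.2.2 = true) := by
    intro i
    fin_cases i
    · simpa [S] using sg0
    · simpa [S] using sg1
    · simpa [S] using sg2
    · simpa [S] using sg3
    · simpa [S] using sg4
    · simpa [S] using sg5
    · simpa [S] using sg6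
    · simpa [S] using sg7
    · simpa [S] using sg8.1
    · simpa [S] using sg9.1
    · simpa [S] using sg10
  refine sg_ne (hS i) (hS j) ?_
  revert i j
  decide

end Co

/-! ### Normalization tools -/

theorem linConj2_trans {A B A' B' A'' B'' : MvPolynomial (Fin 2) ℂ} {M N : Matrix (Fin 2) (Fin 2) ℂ}
    {c d : ℂ} (h : ConjM A B A' B' M c) (h' : ConjM A' B' A'' B'' N d) :
    LinConj2 A B A'' B'' := by
  refine ⟨M * N, c * d, ?_, mul_ne_zero h.2.1 h'.2.1, ?_, ?_⟩
  · rw [Matrix.det_mul]; exact h.1.mul h'.1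
  · have e1 := congrArg (subst2 N) h.2.2.1
    have e2 := congrArg (subst2 N) h.2.2.2
    have e3 := h'.2.2.1
    simp only [subst2_add, subst2_mul, subst2_C] at e1 e2
    have m : ∀ P, subst2 N (subst2 M P) = subst2 (M * N) P := by
      intro P
      apply MvPolynomial.funext; intro v
      simp only [eval_subst2, Matrix.mulVec_mulVec]
    rw [m, m] at e1 e2
    simp only [Matrix.mul_apply, Fin.sum_univ_two, C_add, C_mul]
    linear_combination C (N 0 0) * e1 + C (N 1 0) * e2 + C c * e3
  · have e1 := congrArg (subst2 N) h.2.2.1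
    have e2 := congrArg (subst2 N) h.2.2.2
    have e3 := h'.2.2.2
    simp only [subst2_add, subst2_mul, subst2_C] at e1 e2
    have m : ∀ P, subst2 N (subst2 M P) = subst2 (M * N) P := by
      intro P
      apply MvPolynomial.funext; intro v
      simp only [eval_subst2, Matrix.mulVec_mulVec]
    rw [m, m] at e1 e2
    simp only [Matrix.mul_apply, Fin.sum_univ_two, C_add, C_mul]
    linear_combination C (N 0 1) * e1 + C (N 1 1) * e2 + C c * e3

namespace Co

def NZ (c : Co) : Prop := ∀ x y, (x ≠ 0 ∨ y ≠ 0) → c.ea x y = 0 → c.eb x y = 0 → False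
def Good (c : Co) : Prop := c.NZ ∧ FlatP c.PA c.PB
def Target (c : Co) : Prop := ∃ i, LinConj2 c.PA c.PB (om i).PA (om i).PB
def NoD (c : Co) : Prop := ∀ x y, (x ≠ 0 ∨ y ≠ 0) → c.dx x y = 0 → c.dy x y = 0 → False

theorem Good.s1 {c : Co} (g : c.Good) (x y : ℂ) (h : x ≠ 0 ∨ y ≠ 0) (h1 : c.dv x y = 0)
    (h2 : c.dx x y = 0 → c.dy x y = 0 → False) (h3 : c.cn x y ≠ 0) :
    c.cn (c.eb x y) (-c.ea x y) = 0 := by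
  have := g.2.1 (x, y) (ne_pt h) ((k1_iff h).2 h1) (fun h' => by
    have := (k2_iff h).1 h'; exact h2 this.1 this.2) (fun h' => h3 ((fx_iff h).1 h'))
  exact (nx_iff (ne_F h3)).1 this

theorem Good.s2 {c : Co} (g : c.Good) (x y : ℂ) (h : x ≠ 0 ∨ y ≠ 0) (h1 : c.dx x y = 0)
    (h2 : c.dy x y = 0)
    (h3 : ¬ (6 * c.d0 * x ^ 2 + 3 * c.d1 * x * y + c.d2 * y ^ 2 = 0 ∧
      c.d2 * x ^ 2 + 3 * c.d3 * x * y + 6 * c.d4 * y ^ 2 = 0))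
    (h4 : c.cn x y ≠ 0) : c.wd x y = 0 :=
  (wd_iff h).1 (g.2.2 (x, y) (ne_pt h) ((k2_iff h).2 ⟨h1, h2⟩) (fun h' => h3 (k3_imp h'))
    (fun h' => h4 ((fx_iff h).1 h')))

def tr (c : Co) (p q r s : ℂ) : Co where
  a0 := p * c.ea p r + r * c.eb p r
  a1 := p * (3 * c.a0 * p ^ 2 * q + c.a1 * (p ^ 2 * s + 2 * p * q * r)
      + c.a2 * (2 * p * r * s + q * r ^ 2) + 3 * c.a3 * r ^ 2 * s)
    + r * (3 * c.b0 * p ^ 2 * q + c.b1 * (p ^ 2 * s + 2 * p * q * r)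
      + c.b2 * (2 * p * r * s + q * r ^ 2) + 3 * c.b3 * r ^ 2 * s)
  a2 := p * (3 * c.a0 * p * q ^ 2 + c.a1 * (2 * p * q * s + q ^ 2 * r)
      + c.a2 * (p * s ^ 2 + 2 * q * r * s) + 3 * c.a3 * r * s ^ 2)
    + r * (3 * c.b0 * p * q ^ 2 + c.b1 * (2 * p * q * s + q ^ 2 * r)
      + c.b2 * (p * s ^ 2 + 2 * q * r * s) + 3 * c.b3 * r * s ^ 2)
  a3 := p * c.ea q s + r * c.eb q s
  b0 := q * c.ea p r + s * c.eb p r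
  b1 := q * (3 * c.a0 * p ^ 2 * q + c.a1 * (p ^ 2 * s + 2 * p * q * r)
      + c.a2 * (2 * p * r * s + q * r ^ 2) + 3 * c.a3 * r ^ 2 * s)
    + s * (3 * c.b0 * p ^ 2 * q + c.b1 * (p ^ 2 * s + 2 * p * q * r)
      + c.b2 * (2 * p * r * s + q * r ^ 2) + 3 * c.b3 * r ^ 2 * s)
  b2 := q * (3 * c.a0 * p * q ^ 2 + c.a1 * (2 * p * q * s + q ^ 2 * r)
      + c.a2 * (p * s ^ 2 + 2 * q * r * s) + 3 * c.a3 * r * s ^ 2)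
    + s * (3 * c.b0 * p * q ^ 2 + c.b1 * (2 * p * q * s + q ^ 2 * r)
      + c.b2 * (p * s ^ 2 + 2 * q * r * s) + 3 * c.b3 * r * s ^ 2)
  b3 := q * c.ea q s + s * c.eb q s

def smul (k : ℂ) (c : Co) : Co :=
  ⟨k * c.a0, k * c.a1, k * c.a2, k * c.a3, k * c.b0, k * c.b1, k * c.b2, k * c.b3⟩

/-- `c` is conjugate to `c'` by the matrix `!![p, q; r, s]` with constant `k`. -/
def Rel (c c' : Co) (p q r s k : ℂ) : Prop :=
  p * s - q * r ≠ 0 ∧ k ≠ 0 ∧ c.tr p q r s = smul k c'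

theorem ea_tr (c : Co) (p q r s x y : ℂ) : (c.tr p q r s).ea x y =
    p * c.ea (p * x + q * y) (r * x + s * y) + r * c.eb (p * x + q * y) (r * x + s * y) := by
  simp only [ea, tr, eb]; ring
theorem eb_tr (c : Co) (p q r s x y : ℂ) : (c.tr p q r s).eb x y =
    q * c.ea (p * x + q * y) (r * x + s * y) + s * c.eb (p * x + q * y) (r * x + s * y) := by
  simp only [ea, tr, eb]; ring

theorem smul_one (c : Co) : smul 1 c = c := by simp [smul]
theorem rel_tr (c : Co) (p q r s : ℂ) (h : p * s - q * r ≠ 0) : Rel c (c.tr p q r s) p q r s 1 :=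
  ⟨h, one_ne_zero, (smul_one _).symm⟩

section rel
variable {c c' : Co} {p q r s k : ℂ}

theorem Rel.ea (h : Rel c c' p q r s k) (x y : ℂ) : k * c'.ea x y =
    p * c.ea (p * x + q * y) (r * x + s * y) + r * c.eb (p * x + q * y) (r * x + s * y) := by
  rw [← ea_tr, h.2.2]; simp only [Co.ea, smul]; ring
theorem Rel.eb (h : Rel c c' p q r s k) (x y : ℂ) : k * c'.eb x y =
    q * c.ea (p * x + q * y) (r * x + s * y) + s * c.eb (p * x + q * y) (r * x + s * y) := by
  rw [← eb_tr, h.2.2]; simp only [Co.eb, smul]; ring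

theorem ev2 (v : Fin 2 → ℂ) (P : MvPolynomial (Fin 2) ℂ) : eval v P = eval ![v 0, v 1] P := by
  congr 2; ext i; fin_cases i <;> rfl

theorem Rel.conj (h : Rel c c' p q r s k) : ConjM c.PA c.PB c'.PA c'.PB !![p, q; r, s] k := by
  refine ⟨?_, h.2.1, ?_, ?_⟩
  · rw [Matrix.det_fin_two_of, isUnit_iff_ne_zero]; exact h.1
  · apply MvPolynomial.funext; intro v
    have e : (!![p, q; r, s] : Matrix (Fin 2) (Fin 2) ℂ).mulVec v =
        ![p * v 0 + q * v 1, r * v 0 + s * v 1] := by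
      ext i; fin_cases i <;> simp [Matrix.mulVec, dotProduct, Fin.sum_univ_two]
    rw [map_add, map_mul, map_mul, map_mul, eval_subst2, eval_subst2, e, ev_PA, ev_PB, ev2 v c'.PA, ev_PA]
    simp only [eval_C]
    rw [h.ea]; simp
  · apply MvPolynomial.funext; intro v
    have e : (!![p, q; r, s] : Matrix (Fin 2) (Fin 2) ℂ).mulVec v =
        ![p * v 0 + q * v 1, r * v 0 + s * v 1] := by
      ext i; fin_cases i <;> simp [Matrix.mulVec, dotProduct, Fin.sum_univ_two]
    rw [map_add, map_mul, map_mul, map_mul, eval_subst2, eval_subst2, e, ev_PA, ev_PB, ev2 v c'.PB, ev_PB]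
    simp only [eval_C]
    rw [h.eb]; simp

theorem Rel.ne (h : Rel c c' p q r s k) {x y : ℂ} (hx : x ≠ 0 ∨ y ≠ 0) :
    p * x + q * y ≠ 0 ∨ r * x + s * y ≠ 0 := by
  by_contra h'
  push Not at h'
  have e1 : (p * s - q * r) * x = 0 := by linear_combination s * h'.1 - q * h'.2
  have e2 : (p * s - q * r) * y = 0 := by linear_combination p * h'.2 - r * h'.1
  have e1 := (mul_eq_zero.1 e1).resolve_left h.1
  have e2 := (mul_eq_zero.1 e2).resolve_left h.1
  tauto

theorem Rel.dv (h : Rel c c' p q r s k) {x y : ℂ} (hx : x ≠ 0 ∨ y ≠ 0) :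
    c'.dv x y = 0 ↔ c.dv (p * x + q * y) (r * x + s * y) = 0 := by
  rw [← k1_iff hx, ← k1_iff (h.ne hx)]
  have := conj_KK h.conj 1 (x, y)
  simpa [mv] using this

theorem Rel.db (h : Rel c c' p q r s k) {x y : ℂ} (hx : x ≠ 0 ∨ y ≠ 0) :
    (c'.dx x y = 0 ∧ c'.dy x y = 0) ↔ (c.dx (p * x + q * y) (r * x + s * y) = 0 ∧
      c.dy (p * x + q * y) (r * x + s * y) = 0) := by
  rw [← k2_iff hx, ← k2_iff (h.ne hx)]
  have := conj_KK h.conj 2 (x, y)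
  simpa [mv] using this

theorem Rel.cn (h : Rel c c' p q r s k) {x y : ℂ} :
    c'.cn x y = 0 ↔ c.cn (p * x + q * y) (r * x + s * y) = 0 := by
  have e : k * c'.cn x y = c.cn (p * x + q * y) (r * x + s * y) := by
    simp only [Co.cn]
    linear_combination x * h.ea x y + y * h.eb x y
  rw [← e, mul_eq_zero]; simp [h.2.1]

theorem Rel.good (h : Rel c c' p q r s k) (g : c.Good) : c'.Good := by
  refine ⟨?_, (conj_flat h.conj).2 g.2⟩
  intro x y hx h1 h2
  have e1 := h.ea x y
  have e2 := h.eb x y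
  rw [h1, mul_zero] at e1
  rw [h2, mul_zero] at e2
  refine g.1 _ _ (h.ne hx) ((mul_eq_zero.1 (?_ : (p * s - q * r) * _ = 0)).resolve_left h.1)
    ((mul_eq_zero.1 (?_ : (p * s - q * r) * _ = 0)).resolve_left h.1)
  · linear_combination r * e2 - s * e1
  · linear_combination q * e1 - p * e2

theorem Rel.target (h : Rel c c' p q r s k) (t : c'.Target) : c.Target := by
  obtain ⟨i, M, l, h'⟩ := t
  exact ⟨i, linConj2_trans h.conj (show ConjM _ _ _ _ M l from h')⟩

theorem Rel.nod (h : Rel c c' p q r s k) (t : c.NoD) : c'.NoD := by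
  intro x y hx h1 h2
  have := (h.db hx).1 ⟨h1, h2⟩
  exact t _ _ (h.ne hx) this.1 this.2

theorem Rel.om (i : Fin 11) (h : Rel c (om i) p q r s k) : c.Target :=
  ⟨i, _, _, h.conj⟩
end rel

theorem sq_root (a : ℂ) : ∃ z : ℂ, z ^ 2 = a := IsAlgClosed.exists_pow_nat_eq a (by norm_num)

theorem ex_root {n : ℕ} (P : Polynomial ℂ) (h : P.coeff n ≠ 0) (hn : 1 ≤ n) : ∃ z, P.eval z = 0 := by
  obtain ⟨z, hz⟩ := IsAlgClosed.exists_root P (by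
    intro h0
    have := Polynomial.le_degree_of_ne_zero h
    rw [h0] at this
    have : n ≤ 0 := by exact_mod_cast this
    omega)
  exact ⟨z, hz⟩

theorem quad_root (a b c : ℂ) (h : a ≠ 0) : ∃ z, a * z ^ 2 + b * z + c = 0 := by
  obtain ⟨z, hz⟩ := ex_root (n := 2) (Polynomial.C a * Polynomial.X ^ 2 + Polynomial.C b * Polynomial.X
    + Polynomial.C c) (by simpa [Polynomial.coeff_X, Polynomial.coeff_C] using h) (by norm_num)
  exact ⟨z, by simpa using hz⟩

theorem cub_root (a b c d : ℂ) (h : a ≠ 0) : ∃ z, a * z ^ 3 + b * z ^ 2 + c * z + d = 0 := by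
  obtain ⟨z, hz⟩ := ex_root (n := 3) (Polynomial.C a * Polynomial.X ^ 3 + Polynomial.C b * Polynomial.X ^ 2
    + Polynomial.C c * Polynomial.X + Polynomial.C d)
    (by simpa [Polynomial.coeff_X, Polynomial.coeff_C] using h) (by norm_num)
  exact ⟨z, by simpa using hz⟩

theorem qua_root (a b c d e : ℂ) (h : a ≠ 0) :
    ∃ z, a * z ^ 4 + b * z ^ 3 + c * z ^ 2 + d * z + e = 0 := by
  obtain ⟨z, hz⟩ := ex_root (n := 4) (Polynomial.C a * Polynomial.X ^ 4 + Polynomial.C b * Polynomial.X ^ 3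
    + Polynomial.C c * Polynomial.X ^ 2 + Polynomial.C d * Polynomial.X + Polynomial.C e)
    (by simpa [Polynomial.coeff_X, Polynomial.coeff_C] using h) (by norm_num)
  exact ⟨z, by simpa using hz⟩

/-- a quadratic has a double root or two distinct roots -/
theorem quad_alt (a b c : ℂ) (h : a ≠ 0) :
    (∃ z, a * z ^ 2 + b * z + c = 0 ∧ 2 * a * z + b = 0) ∨
    ∃ z w, z ≠ w ∧ a * z ^ 2 + b * z + c = 0 ∧ a * w ^ 2 + b * w + c = 0 ∧ b = -a * (z + w) ∧ c = a * z * w := by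
  obtain ⟨z, hz⟩ := quad_root a b c h
  by_cases hd : 2 * a * z + b = 0
  · exact Or.inl ⟨z, hz, hd⟩
  · right
    refine ⟨z, -b / a - z, ?_, hz, ?_, ?_, ?_⟩
    · intro e; apply hd
      field_simp at e; linear_combination e
    · field_simp; linear_combination a * hz
    · field_simp; ring
    · field_simp; linear_combination hz

theorem cub_alt (a b c d : ℂ) (h : a ≠ 0) :
    (∃ z, a * z ^ 3 + b * z ^ 2 + c * z + d = 0 ∧ 3 * a * z ^ 2 + 2 * b * z + c = 0) ∨
    ∃ z w t, z ≠ w ∧ z ≠ t ∧ w ≠ t ∧ a * z ^ 3 + b * z ^ 2 + c * z + d = 0 ∧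
      a * w ^ 3 + b * w ^ 2 + c * w + d = 0 ∧ a * t ^ 3 + b * t ^ 2 + c * t + d = 0 := by
  obtain ⟨z, hz⟩ := cub_root a b c d h
  by_cases hd : 3 * a * z ^ 2 + 2 * b * z + c = 0
  · exact Or.inl ⟨z, hz, hd⟩
  rcases quad_alt a (b + a * z) (c + b * z + a * z ^ 2) h with ⟨w, h1, h2⟩ | ⟨w, t, hn, h1, h2, -⟩
  · left
    refine ⟨w, ?_, ?_⟩
    · linear_combination hz + (w - z) * h1
    · linear_combination h1 + (w - z) * h2
  · right
    refine ⟨z, w, t, ?_, ?_, hn, hz, ?_, ?_⟩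
    · rintro rfl; apply hd; linear_combination h1
    · rintro rfl; apply hd; linear_combination h2
    · linear_combination hz + (w - z) * h1
    · linear_combination hz + (t - z) * h2

theorem quad_three {a b c z w t : ℂ} (h1 : z ≠ w) (h2 : z ≠ t) (h3 : w ≠ t)
    (e1 : a * z ^ 2 + b * z + c = 0) (e2 : a * w ^ 2 + b * w + c = 0) (e3 : a * t ^ 2 + b * t + c = 0) :
    a = 0 ∧ b = 0 ∧ c = 0 := by
  have f1 : a * (z + w) + b = 0 := by
    apply (mul_eq_zero.1 (?_ : (z - w) * _ = 0)).resolve_left (sub_ne_zero.2 h1)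
    linear_combination e1 - e2
  have f2 : a * (z + t) + b = 0 := by
    apply (mul_eq_zero.1 (?_ : (z - t) * _ = 0)).resolve_left (sub_ne_zero.2 h2)
    linear_combination e1 - e3
  have f3 : a = 0 := by
    apply (mul_eq_zero.1 (?_ : (w - t) * _ = 0)).resolve_left (sub_ne_zero.2 h3)
    linear_combination f1 - f2
  subst f3
  have f4 : b = 0 := by simpa using f1
  subst f4
  exact ⟨rfl, rfl, by simpa using e1⟩

end Co

namespace Co

theorem caseIa2 (k t : ℂ) (hk : k ≠ 0) (g : Good ⟨0, 0, 0, 1, -k, 3 / 2 * k, 0, -t⟩) :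
    Target ⟨0, 0, 0, 1, -k, 3 / 2 * k, 0, -t⟩ := by
  have h0 : t = 0 ∨ t = 3 / 2 := by
    by_cases ht : t = 0
    · exact Or.inl ht
    have := g.s1 0 1 (by simp) (by simp [dv, d4])
      (fun h _ => by simp [dx, d3] at h; exact hk h)
      (by simpa [cn, ea, eb] using ht)
    simp only [cn, ea, eb] at this
    right
    have e : k * t ^ 2 * (t - 3 / 2) = 0 := by linear_combination -this
    simp only [mul_eq_zero, sub_eq_zero] at e
    grind
  have h1 : t = 1 + k / 2 ∨ (t - k / 2) - k * (t - k / 2) ^ 3 + 3 / 2 * k * (t - k / 2) ^ 2 - t = 0 := by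
    by_cases ht : t = 1 + k / 2
    · exact Or.inl ht
    have := g.s1 1 1 (by simp) (by simp only [dv, d0, d1, d2, d3, d4]; ring)
      (fun h _ => hk (by simp only [dx, d0, d1, d2, d3, d4] at h; linear_combination h / 9))
      (fun h => ht (by simp only [cn, ea, eb] at h; linear_combination -h))
    simp only [cn, ea, eb] at this
    right
    linear_combination this
  rcases h0 with rfl | rfl
  · rcases h1 with h1 | h1
    · have : k = -2 := by linear_combination -2 * h1
      subst this
      refine Rel.om (p := 1) (q := 0) (r := 1) (s := 1) (k := 1) 2 ⟨by norm_num, by norm_num, ?_⟩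
      rw [om2]; simp only [tr, smul, ea, eb, mk.injEq]; norm_num
    · have : k * ((k - 1) * (k + 2) ^ 2) = 0 := by linear_combination 8 * h1
      have := (mul_eq_zero.1 this).resolve_left hk
      rcases mul_eq_zero.1 this with h | h
      · have : k = 1 := by linear_combination h
        subst this
        refine Rel.om (p := 1) (q := 0) (r := 0) (s := 1) (k := 1 / 2) 4 ⟨by norm_num, by norm_num, ?_⟩
        rw [om4]; simp only [tr, smul, ea, eb, mk.injEq]; norm_num
      · have : k = -2 := by linear_combination pow_eq_zero_iff (two_ne_zero) |>.1 h
        subst this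
        refine Rel.om (p := 1) (q := 0) (r := 1) (s := 1) (k := 1) 2 ⟨by norm_num, by norm_num, ?_⟩
        rw [om2]; simp only [tr, smul, ea, eb, mk.injEq]; norm_num
  · have : k = 1 ∨ k = 4 := by
      rcases h1 with h1 | h1
      · left; linear_combination -2 * h1
      · have : k * ((k - 1) ^ 2 * (k - 4)) = 0 := by linear_combination 8 * h1
        have := (mul_eq_zero.1 this).resolve_left hk
        simp only [mul_eq_zero, pow_eq_zero_iff two_ne_zero, sub_eq_zero] at this
        exact this
    rcases this with rfl | rfl
    · refine Rel.om (p := -1) (q := 1) (r := 0) (s := 1) (k := -1 / 2) 4 ⟨by norm_num, by norm_num, ?_⟩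
      rw [om4]; simp only [tr, smul, ea, eb, mk.injEq]; norm_num
    · refine Rel.om (p := 1) (q := 1) (r := 0) (s := 2) (k := 8) 6 ⟨by norm_num, by norm_num, ?_⟩
      rw [om6]; simp only [tr, smul, ea, eb, mk.injEq]; norm_num

theorem caseIa1 (a b0 b1 b3 : ℂ) (ha : a ≠ 0) (hb : b0 ≠ 0) (g : Good ⟨0, 0, 0, a, b0, b1, 0, b3⟩) :
    Target ⟨0, 0, 0, a, b0, b1, 0, b3⟩ := by
  by_cases h1 : b1 = 0
  · subst h1
    have h3 : b3 = 0 := by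
      by_contra h3
      have := g.s2 0 1 (by simp) (by simp [dx, d3]) (by simp [dy, d4])
        (by simp [d0, d1, d2, ha, hb]) (by simpa [cn, ea, eb] using h3)
      simp [wd, ha] at this
    subst h3
    obtain ⟨p, hp⟩ := sq_root (-a / b0)
    have hp0 : p ≠ 0 := by
      rintro rfl
      have : -a / b0 ≠ 0 := div_ne_zero (neg_ne_zero.2 ha) hb
      apply this; rw [← hp]; norm_num
    have hp' : b0 * p ^ 2 = -a := by rw [hp]; field_simp
    refine Rel.om (p := p) (q := 0) (r := 0) (s := 1) (k := p * a) 0 ⟨by simpa using hp0, mul_ne_zero hp0 ha, ?_⟩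
    rw [om0]; simp only [tr, smul, ea, eb, mk.injEq]; simp
    linear_combination p * hp'
  · obtain ⟨z, hz⟩ : ∃ z, b1 = -3 / 2 * b0 * z := ⟨-2 * b1 / (3 * b0), by field_simp⟩
    have hz0 : z ≠ 0 := by rintro rfl; apply h1; rw [hz]; ring
    subst hz
    have R : Rel ⟨0, 0, 0, a, b0, -3 / 2 * b0 * z, 0, b3⟩
        ⟨0, 0, 0, 1, -(-b0 * z ^ 2 / a), 3 / 2 * (-b0 * z ^ 2 / a), 0, -(-b3 / (z * a))⟩ z 0 0 1 (z * a) := by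
      refine ⟨by simpa using hz0, mul_ne_zero hz0 ha, ?_⟩
      simp only [tr, smul, ea, eb, mk.injEq]
      refine ⟨?_, ?_, ?_, ?_, ?_, ?_, ?_, ?_⟩ <;> field_simp <;> ring
    refine R.target (caseIa2 _ _ ?_ (R.good g))
    exact div_ne_zero (mul_ne_zero (neg_ne_zero.2 hb) (pow_ne_zero 2 hz0)) ha

theorem caseIa (c : Co) (g : c.Good) (h1 : c.dx 1 0 = 0) (h2 : c.dy 1 0 = 0) (h3 : c.cn 1 0 = 0) :
    c.Target := by
  obtain ⟨a0, a1, a2, a3, b0, b1, b2, b3⟩ := c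
  simp [cn, ea] at h3
  subst h3
  have hb : b0 ≠ 0 := by
    rintro rfl
    exact g.1 1 0 (by simp) (by simp [ea]) (by simp [eb])
  simp [dx, d0, hb] at h1
  simp [dy, d1, hb] at h2
  subst h1; subst h2
  have ha : a3 ≠ 0 := by
    rintro rfl
    obtain ⟨z, hz⟩ := cub_root b0 b1 b2 b3 hb
    exact g.1 z 1 (by simp) (by simp [ea]) (by simpa [eb] using hz)
  obtain ⟨z, hz⟩ := quad_root (3 * b0) (2 * b1) b2 (by simpa using hb)
  have R := rel_tr ⟨0, 0, 0, a3, b0, b1, b2, b3⟩ 1 z 0 1 (by simp)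
  have e : tr ⟨0, 0, 0, a3, b0, b1, b2, b3⟩ 1 z 0 1 =
      ⟨0, 0, 0, a3, b0, 3 * b0 * z + b1, 0, z * a3 + b0 * z ^ 3 + b1 * z ^ 2 + b2 * z + b3⟩ := by
    simp only [tr, ea, eb, mk.injEq]
    refine ⟨?_, ?_, ?_, ?_, ?_, ?_, ?_, ?_⟩ <;> try ring
    linear_combination hz
  rw [e] at R
  exact R.target (caseIa1 _ _ _ _ ha hb (R.good g))

theorem caseIb2 (q k : ℂ) (hk : k ≠ 0) (g : Good ⟨1, 0, -3, q, 0, 0, 0, -k⟩) :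
    Target ⟨1, 0, -3, q, 0, 0, 0, -k⟩ := by
  have h1 : k = q - 2 ∨ k = 4 - 2 * q := by
    by_cases ht : k = q - 2
    · exact Or.inl ht
    have := g.s1 1 1 (by simp) (by simp only [dv, d0, d1, d2, d3, d4]; ring)
      (fun h _ => hk (by simp only [dx, d0, d1, d2, d3, d4] at h; linear_combination -h / 18))
      (fun h => ht (by simp only [cn, ea, eb] at h; linear_combination -h))
    simp only [cn, ea, eb] at this
    right
    have e : k * (k - q + 2) ^ 2 * (k - 4 + 2 * q) = 0 := by linear_combination this
    have e := (mul_eq_zero.1 e).resolve_left (mul_ne_zero hk (pow_ne_zero 2 (fun h => ht (by linear_combination h))))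
    linear_combination e
  have h2 : k = -(q + 2) ∨ k = 2 * q + 4 := by
    by_cases ht : k = -(q + 2)
    · exact Or.inl ht
    have := g.s1 (-1) 1 (by simp) (by simp only [dv, d0, d1, d2, d3, d4]; ring)
      (fun h _ => hk (by simp only [dx, d0, d1, d2, d3, d4] at h; linear_combination h / 18))
      (fun h => ht (by simp only [cn, ea, eb] at h; linear_combination -h))
    simp only [cn, ea, eb] at this
    right
    have e : k * (k + q + 2) ^ 2 * (k - 4 - 2 * q) = 0 := by linear_combination this
    have e := (mul_eq_zero.1 e).resolve_left (mul_ne_zero hk (pow_ne_zero 2 (fun h => ht (by linear_combination h))))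
    linear_combination e
  rcases h1 with h1 | h1 <;> rcases h2 with h2 | h2
  · have e1 : q = 0 := by linear_combination (h2 - h1) / 2
    have e2 : k = -2 := by rw [h1, e1]; ring
    subst e1; subst e2
    refine Rel.om (p := -1) (q := 1) (r := 1) (s := 1) (k := 4) 3 ⟨by norm_num, by norm_num, ?_⟩
    rw [om3]; simp only [tr, smul, ea, eb, mk.injEq]; norm_num
  · have e1 : q = -6 := by linear_combination (h1 - h2)
    have e2 : k = -8 := by rw [h1, e1]; ring
    subst e1; subst e2
    refine Rel.om (p := -2) (q := 1) (r := 0) (s := 1) (k := 4) 5 ⟨by norm_num, by norm_num, ?_⟩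
    rw [om5]; simp only [tr, smul, ea, eb, mk.injEq]; norm_num
  · have e1 : q = 6 := by linear_combination (h1 - h2)
    have e2 : k = -8 := by rw [h1, e1]; ring
    subst e1; subst e2
    refine Rel.om (p := 2) (q := -1) (r := 0) (s := 1) (k := 4) 5 ⟨by norm_num, by norm_num, ?_⟩
    rw [om5]; simp only [tr, smul, ea, eb, mk.injEq]; norm_num
  · have e1 : q = 0 := by linear_combination (h1 - h2) / 4
    have e2 : k = 4 := by rw [h1, e1]; ring
    subst e1; subst e2
    refine Rel.om (p := 1) (q := 0) (r := 0) (s := 1) (k := 1) 7 ⟨by norm_num, by norm_num, ?_⟩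
    rw [om7]; simp only [tr, smul, ea, eb, mk.injEq]; norm_num

theorem caseIb1 (c : Co) (g : c.Good) (h1 : c.dx 1 0 = 0) (h2 : c.dy 1 0 = 0) (h3 : c.a0 ≠ 0)
    (h4 : c.b0 = 0) : c.Target := by
  obtain ⟨a0, a1, a2, a3, b0, b1, b2, b3⟩ := c
  simp only at h3 h4
  subst h4
  simp [dx, d0, h3] at h1
  simp [dy, d1, h3] at h2
  subst h1; subst h2
  have hb : b3 ≠ 0 := by
    rintro rfl
    obtain ⟨z, hz⟩ := cub_root a0 a1 a2 a3 h3
    exact g.1 z 1 (by simp) (by simpa [ea] using hz) (by simp [eb])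
  have ha : a1 = 0 := by
    have := g.s2 1 0 (by simp) (by simp [dx, d0]) (by simp [dy, d1])
      (by simp [d0, d1, d2, h3, hb]) (by simpa [cn, ea, eb] using h3)
    simpa [wd] using this
  subst ha
  by_cases ha : a2 = 0
  · subst ha
    have h3' : a3 = 0 := by
      have := g.s2 0 1 (by simp) (by simp [dx, d3]) (by simp [dy, d4])
        (by simp [d0, d1, d2, h3, hb]) (by simpa [cn, ea, eb] using hb)
      simpa [wd] using this
    subst h3'
    obtain ⟨p, hp⟩ := IsAlgClosed.exists_pow_nat_eq (-b3 / a0) (n := 4) (by norm_num)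
    have hp0 : p ≠ 0 := by
      rintro rfl
      have : -b3 / a0 ≠ 0 := div_ne_zero (neg_ne_zero.2 hb) h3
      apply this; rw [← hp]; norm_num
    have hp' : a0 * p ^ 4 = -b3 := by rw [hp]; field_simp
    refine Rel.om (p := p) (q := 0) (r := 0) (s := 1) (k := -b3) 1 ⟨by simpa using hp0, neg_ne_zero.2 hb, ?_⟩
    rw [om1]; simp only [tr, smul, ea, eb, mk.injEq]; simp
    linear_combination hp'
  · obtain ⟨z, hz⟩ := sq_root (-a2 / (3 * a0))
    have hz0 : z ≠ 0 := by
      rintro rfl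
      have : -a2 / (3 * a0) ≠ 0 := div_ne_zero (neg_ne_zero.2 ha) (mul_ne_zero (by norm_num) h3)
      apply this; rw [← hz]; norm_num
    have hz' : a2 = -3 * a0 * z ^ 2 := by rw [hz]; field_simp
    subst hz'
    have R : Rel ⟨a0, 0, -3 * a0 * z ^ 2, a3, 0, 0, 0, b3⟩
        ⟨1, 0, -3, a3 / (a0 * z ^ 3), 0, 0, 0, -(-b3 / (a0 * z ^ 4))⟩ z 0 0 1 (a0 * z ^ 4) := by
      refine ⟨by simpa using hz0, mul_ne_zero h3 (pow_ne_zero _ hz0), ?_⟩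
      simp only [tr, smul, ea, eb, mk.injEq]
      refine ⟨?_, ?_, ?_, ?_, ?_, ?_, ?_, ?_⟩ <;> field_simp <;> ring
    refine R.target (caseIb2 _ _ ?_ (R.good g))
    exact div_ne_zero (neg_ne_zero.2 hb) (mul_ne_zero h3 (pow_ne_zero _ hz0))

theorem caseIb (c : Co) (g : c.Good) (h1 : c.dx 1 0 = 0) (h2 : c.dy 1 0 = 0) (h3 : c.cn 1 0 ≠ 0) :
    c.Target := by
  have h3 : c.a0 ≠ 0 := by simpa [cn, ea] using h3
  have R := rel_tr c 1 c.b0 0 (-c.a0) (by simpa using h3)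
  have hd := (R.db (x := 1) (y := 0) (by simp)).2 (by simpa using ⟨h1, h2⟩)
  refine R.target (caseIb1 _ (R.good g) hd.1 hd.2 ?_ ?_)
  · simpa [tr, ea] using h3
  · simp [tr, ea, eb]; ring

/-- complete a nonzero vector to a basis -/
theorem compl (x y : ℂ) (h : x ≠ 0 ∨ y ≠ 0) : ∃ u v, x * v - u * y ≠ 0 := by
  by_cases hx : x = 0
  · exact ⟨1, 0, by simp; tauto⟩
  · exact ⟨0, 1, by simpa using hx⟩

theorem caseI (c : Co) (g : c.Good) (h : ¬ c.NoD) : c.Target := by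
  unfold NoD at h
  push Not at h
  obtain ⟨x, y, hx, h1, h2, -⟩ := h
  obtain ⟨u, v, hn⟩ := compl x y hx
  have R := rel_tr c x u y v hn
  have hd := (R.db (x := 1) (y := 0) (by simp)).2 (by simpa using ⟨h1, h2⟩)
  by_cases h3 : (c.tr x u y v).cn 1 0 = 0
  · exact R.target (caseIa _ (R.good g) hd.1 hd.2 h3)
  · exact R.target (caseIb _ (R.good g) hd.1 hd.2 h3)

end Co

namespace Co

theorem NoD.s1 {c : Co} (n : c.NoD) (g : c.Good) (x y : ℂ) (h : x ≠ 0 ∨ y ≠ 0) (h1 : c.dv x y = 0)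
    (h3 : c.cn x y ≠ 0) : c.cn (c.eb x y) (-c.ea x y) = 0 :=
  g.s1 x y h h1 (n x y h) h3

/-! #### one fixed critical point gives a second one -/

theorem caseII1b (b0 b1 b2 b3 : ℂ) (g : Good ⟨0, 0, 1, 0, b0, b1, b2, b3⟩)
    (n : NoD ⟨0, 0, 1, 0, b0, b1, b2, b3⟩) :
    ∃ z, dv ⟨0, 0, 1, 0, b0, b1, b2, b3⟩ z 1 = 0 ∧ cn ⟨0, 0, 1, 0, b0, b1, b2, b3⟩ z 1 = 0 := by
  have hb0 : b0 ≠ 0 := by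
    rintro rfl
    exact g.1 1 0 (by simp) (by simp [ea]) (by simp [eb])
  have hb3 : b3 ≠ 0 := by
    rintro rfl
    exact g.1 0 1 (by simp) (by simp [ea]) (by simp [eb])
  rcases cub_alt (2 * b0) b1 0 (-b3) (by simpa using hb0) with ⟨z, h1, h2⟩ | ⟨z, w, t, n1, n2, n3, e1, e2, e3⟩
  · refine (n z 1 (by simp) ?_ ?_).elim
    · simp only [dx, d0, d1, d2, d3, d4]; linear_combination -3 * h2
    · simp only [dy, d0, d1, d2, d3, d4]; linear_combination -12 * h1 + 3 * z * h2
  · by_contra hc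
    push Not at hc
    have key : ∀ c : ℂ, 2 * b0 * c ^ 3 + b1 * c ^ 2 + 0 * c + -b3 = 0 →
        3 * b0 ^ 2 * c ^ 2 + (2 * b0 * b1 - 2 * b0) * c + (b0 * b2 - b1) = 0 := by
      intro c hc'
      have hc0 : c ≠ 0 := by
        rintro rfl; apply hb3; linear_combination -hc'
      have hd : dv ⟨0, 0, 1, 0, b0, b1, b2, b3⟩ c 1 = 0 := by
        simp only [dv, d0, d1, d2, d3, d4]; linear_combination -3 * hc'
      have h3 := hc c hd
      have h4 := n.s1 g c 1 (by simp) hd h3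
      obtain ⟨e, he⟩ : ∃ e, e = -(3 * b0 * c ^ 2 + 2 * b1 * c + b2) := ⟨_, rfl⟩
      have he2 : eb ⟨0, 0, 1, 0, b0, b1, b2, b3⟩ c 1 = -c * e := by
        simp only [eb]; rw [he]; linear_combination -hc'
      have he3 : -ea ⟨0, 0, 1, 0, b0, b1, b2, b3⟩ c 1 = -c * 1 := by
        simp only [ea]; ring
      rw [he2, he3, sc_cn _ _ _ (neg_ne_zero.2 hc0)] at h4
      have h5 : (e - c) ^ 2 * (b0 * e + 2 * b0 * c + b1) = 0 := by
        simp only [cn, ea, eb] at h4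
        linear_combination h4 - e * he + hc'
      have hne : e - c ≠ 0 := by
        intro h
        have : e = c := by linear_combination h
        rw [this] at h4
        exact h3 h4
      have h6 := (mul_eq_zero.1 h5).resolve_left (pow_ne_zero 2 hne)
      linear_combination -h6 + b0 * he
    have := quad_three n1 n2 n3 (key _ e1) (key _ e2) (key _ e3)
    apply hb0
    simpa using this.1

theorem caseII1a (c : Co) (g : c.Good) (n : c.NoD) (h1 : c.dv 1 0 = 0) (h2 : c.cn 1 0 = 0) :
    ∃ z, c.dv z 1 = 0 ∧ c.cn z 1 = 0 := by
  obtain ⟨a0, a1, a2, a3, b0, b1, b2, b3⟩ := c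
  simp [cn, ea] at h2
  subst h2
  have hb : b0 ≠ 0 := by
    rintro rfl
    exact g.1 1 0 (by simp) (by simp [ea]) (by simp [eb])
  simp [dv, d0, hb] at h1
  subst h1
  have ha : a2 ≠ 0 := by
    rintro rfl
    exact n 1 0 (by simp) (by simp [dx, d0]) (by simp [dy, d1])
  obtain ⟨z, hz⟩ : ∃ z, a3 = -a2 * z := ⟨-a3 / a2, by field_simp⟩
  subst hz
  have R : Rel ⟨0, 0, a2, -a2 * z, b0, b1, b2, b3⟩
      ⟨0, 0, 1, 0, b0 / a2, (3 * b0 * z + b1) / a2, (3 * b0 * z ^ 2 + 2 * b1 * z + b2) / a2 + z,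
        (b0 * z ^ 3 + b1 * z ^ 2 + b2 * z + b3) / a2⟩ 1 z 0 1 a2 := by
    refine ⟨by simp, ha, ?_⟩
    simp only [tr, smul, ea, eb, mk.injEq]
    refine ⟨?_, ?_, ?_, ?_, ?_, ?_, ?_, ?_⟩ <;> field_simp <;> ring
  obtain ⟨w, k1, k2⟩ := caseII1b _ _ _ _ (R.good g) (R.nod n)
  rw [R.dv (by simp)] at k1
  rw [R.cn] at k2
  refine ⟨w + z, ?_, ?_⟩
  · simpa using k1
  · simpa using k2

/-! #### two fixed critical points -/

theorem caseII2a (b : ℂ) (hb0 : b ≠ 0) (hb1 : b + 1 ≠ 0) (hb2 : b + 2 ≠ 0) (hb3 : 2 * b + 3 ≠ 0)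
    (g : Good ⟨0, 0, 2 * b + 3, -(b + 2), -1, -b, 0, 0⟩)
    (n : NoD ⟨0, 0, 2 * b + 3, -(b + 2), -1, -b, 0, 0⟩) :
    Target ⟨0, 0, 2 * b + 3, -(b + 2), -1, -b, 0, 0⟩ := by
  have hb4 : b + 3 ≠ 0 := by
    intro h
    have : b = -3 := by linear_combination h
    subst this
    refine n 1 1 (by simp) ?_ ?_
    · simp only [dx, d0, d1, d2, d3, d4]; norm_num
    · simp only [dy, d0, d1, d2, d3, d4]; norm_num
  have hd : dv ⟨0, 0, 2 * b + 3, -(b + 2), -1, -b, 0, 0⟩ (-(b * (b + 2))) (2 * b + 3) = 0 := by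
    simp only [dv, d0, d1, d2, d3, d4]; ring
  have hc : cn ⟨0, 0, 2 * b + 3, -(b + 2), -1, -b, 0, 0⟩ (-(b * (b + 2))) (2 * b + 3) ≠ 0 := by
    have : cn ⟨0, 0, 2 * b + 3, -(b + 2), -1, -b, 0, 0⟩ (-(b * (b + 2))) (2 * b + 3) =
      3 * b * (b + 2) ^ 2 * (2 * b + 3) * (b + 1) ^ 2 * (b + 3) := by
      simp only [cn, ea, eb]; ring
    rw [this]
    simp [hb0, hb1, hb2, hb3, hb4]
  have h1 := n.s1 g _ _ (Or.inr hb3) hd hc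
  have e1 : eb ⟨0, 0, 2 * b + 3, -(b + 2), -1, -b, 0, 0⟩ (-(b * (b + 2))) (2 * b + 3) =
      ((b + 1) * (b + 2)) * (-b ^ 3 * (b + 2)) := by
    simp only [eb]; ring
  have e2 : -ea ⟨0, 0, 2 * b + 3, -(b + 2), -1, -b, 0, 0⟩ (-(b * (b + 2))) (2 * b + 3) =
      ((b + 1) * (b + 2)) * ((2 * b + 3) ^ 3) := by
    simp only [ea]; ring
  rw [e1, e2, sc_cn _ _ _ (mul_ne_zero hb1 hb2)] at h1
  have e3 : cn ⟨0, 0, 2 * b + 3, -(b + 2), -1, -b, 0, 0⟩ (-b ^ 3 * (b + 2)) ((2 * b + 3) ^ 3) =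
      (9 * b ^ 3 * (b + 2) ^ 2 * (2 * b + 3) ^ 3 * (b + 3) ^ 3 * (b + 1) ^ 2) * (b ^ 2 + 3 * b + 3) := by
    simp only [cn, ea, eb]; ring
  rw [e3] at h1
  have h2 := (mul_eq_zero.1 h1).resolve_left (by simp [hb0, hb1, hb2, hb3, hb4])
  have hw := is3_sq
  have h3 : (2 * b + 3 - is3) * (2 * b + 3 + is3) = 0 := by linear_combination 4 * h2 - hw
  rcases mul_eq_zero.1 h3 with h | h
  · have hb : b = (-3 + is3) / 2 := by linear_combination h / 2
    refine Rel.om (p := 0) (q := 1) (r := 1) (s := 0) (k := -1 / 2) 8 ⟨by norm_num, by norm_num, ?_⟩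
    rw [om8, hb]; simp only [tr, smul, ea, eb, mk.injEq]
    refine ⟨?_, ?_, ?_, ?_, ?_, ?_, ?_, ?_⟩ <;> ring
  · have hb : b = (-3 - is3) / 2 := by linear_combination h / 2
    refine Rel.om (p := 1) (q := 0) (r := 0) (s := 1) (k := -(1 - is3) / 4) 8 ⟨by norm_num, ?_, ?_⟩
    · have := w_ne (-1) 1 (by norm_num)
      intro h; apply this; linear_combination 4 * h
    rw [om8, hb]; simp only [tr, smul, ea, eb, mk.injEq]
    refine ⟨?_, ?_, ?_, ?_, ?_, ?_, ?_, ?_⟩ <;> grind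

theorem caseII2b (a2 a3 b0 b1 : ℂ) (g : Good ⟨0, 0, a2, a3, b0, b1, 0, 0⟩)
    (n : NoD ⟨0, 0, a2, a3, b0, b1, 0, 0⟩) (h2 : a2 ≠ 0) (h3 : a3 ≠ 0) (h0 : b0 ≠ 0) (h1 : b1 ≠ 0)
    (hd : dv ⟨0, 0, a2, a3, b0, b1, 0, 0⟩ 1 1 = 0) (hc : cn ⟨0, 0, a2, a3, b0, b1, 0, 0⟩ 1 1 = 0) :
    Target ⟨0, 0, a2, a3, b0, b1, 0, 0⟩ := by
  obtain ⟨b, rfl⟩ : ∃ b, b1 = b0 * b := ⟨b1 / b0, by field_simp⟩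
  have hb : b ≠ 0 := right_ne_zero_of_mul h1
  simp only [cn, ea, eb] at hc
  simp only [dv, d0, d1, d2, d3, d4] at hd
  have hb1 : b + 1 ≠ 0 := by
    intro h
    refine g.1 1 1 (by simp) ?_ ?_
    · simp only [ea]; linear_combination hc - b0 * h
    · simp only [eb]; linear_combination b0 * h
  have e2 : a2 = -b0 * (2 * b + 3) := by
    have : b0 * ((b + 1) * (a2 + b0 * (2 * b + 3))) = 0 := by
      linear_combination hd / 3 + (3 * b0 + 2 * b0 * b) * hc
    have := (mul_eq_zero.1 ((mul_eq_zero.1 this).resolve_left h0)).resolve_left hb1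
    linear_combination this
  have e3 : a3 = b0 * (b + 2) := by linear_combination hc - e2
  subst e2; subst e3
  have hb2 : b + 2 ≠ 0 := right_ne_zero_of_mul h3
  have hb3 : 2 * b + 3 ≠ 0 := right_ne_zero_of_mul h2
  have R : Rel ⟨0, 0, -b0 * (2 * b + 3), b0 * (b + 2), b0, b0 * b, 0, 0⟩
      ⟨0, 0, 2 * b + 3, -(b + 2), -1, -b, 0, 0⟩ 1 0 0 1 (-b0) := by
    refine ⟨by simp, neg_ne_zero.2 h0, ?_⟩
    simp only [tr, smul, ea, eb, mk.injEq]
    refine ⟨?_, ?_, ?_, ?_, ?_, ?_, ?_, ?_⟩ <;> ring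
  exact R.target (caseII2a b hb hb1 hb2 hb3 (R.good g) (R.nod n))

theorem caseII2c (a2 a3 b0 b1 : ℂ) (g : Good ⟨0, 0, a2, a3, b0, b1, 0, 0⟩)
    (n : NoD ⟨0, 0, a2, a3, b0, b1, 0, 0⟩) (h2 : a2 ≠ 0) (h3 : a3 ≠ 0) (h0 : b0 ≠ 0) (h1 : b1 ≠ 0) :
    Target ⟨0, 0, a2, a3, b0, b1, 0, 0⟩ := by
  have hdv : ∀ z, 2 * a2 * b0 * z ^ 2 + (3 * a3 * b0 + a2 * b1) * z + 2 * a3 * b1 = 0 →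
      dv ⟨0, 0, a2, a3, b0, b1, 0, 0⟩ z 1 = 0 := by
    intro z hz
    simp only [dv, d0, d1, d2, d3, d4]; linear_combination -3 * z * hz
  have hz0 : ∀ z, 2 * a2 * b0 * z ^ 2 + (3 * a3 * b0 + a2 * b1) * z + 2 * a3 * b1 = 0 → z ≠ 0 := by
    rintro z hz rfl
    have : a3 * b1 = 0 := by linear_combination hz / 2
    exact mul_ne_zero h3 h1 this
  have hfix : ∀ z, 2 * a2 * b0 * z ^ 2 + (3 * a3 * b0 + a2 * b1) * z + 2 * a3 * b1 = 0 →
      cn ⟨0, 0, a2, a3, b0, b1, 0, 0⟩ z 1 = 0 → Target ⟨0, 0, a2, a3, b0, b1, 0, 0⟩ := by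
    intro z hz hc
    have z0 := hz0 z hz
    have R := rel_tr ⟨0, 0, a2, a3, b0, b1, 0, 0⟩ z 0 0 1 (by simpa using z0)
    have e : tr ⟨0, 0, a2, a3, b0, b1, 0, 0⟩ z 0 0 1 =
      ⟨0, 0, z ^ 2 * a2, z * a3, z ^ 3 * b0, z ^ 2 * b1, 0, 0⟩ := by
      simp only [tr, ea, eb, mk.injEq]
      refine ⟨?_, ?_, ?_, ?_, ?_, ?_, ?_, ?_⟩ <;> ring
    rw [e] at R
    refine R.target (caseII2b _ _ _ _ (R.good g) (R.nod n) (by simp [h2, z0]) (by simp [h3, z0])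
      (by simp [h0, z0]) (by simp [h1, z0]) ?_ ?_)
    · rw [R.dv (by simp)]; simpa using hdv z hz
    · rw [R.cn]; simpa using hc
  rcases quad_alt (2 * a2 * b0) (3 * a3 * b0 + a2 * b1) (2 * a3 * b1) (by simp [h2, h0]) with
    ⟨z, e1, e2⟩ | ⟨z, w, hzw, e1, e2, e3, e4⟩
  · refine (n z 1 (by simp) ?_ ?_).elim
    · simp only [dx, d0, d1, d2, d3, d4]; linear_combination -3 * e1 - 3 * z * e2
    · simp only [dy, d0, d1, d2, d3, d4]; linear_combination -9 * z * e1 + 3 * z ^ 2 * e2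
  by_cases f1 : cn ⟨0, 0, a2, a3, b0, b1, 0, 0⟩ z 1 = 0
  · exact hfix z e1 f1
  by_cases f2 : cn ⟨0, 0, a2, a3, b0, b1, 0, 0⟩ w 1 = 0
  · exact hfix w e2 f2
  have key : ∀ c, 2 * a2 * b0 * c ^ 2 + (3 * a3 * b0 + a2 * b1) * c + 2 * a3 * b1 = 0 →
      cn ⟨0, 0, a2, a3, b0, b1, 0, 0⟩ c 1 ≠ 0 →
      ∃ e, b1 = -b0 * (2 * c + e) ∧ e * a2 = b0 * (c ^ 2 + 2 * c * e) ∧ a3 = -b0 * c ^ 2 := by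
    intro c hc hf
    have c0 := hz0 c hc
    have h4 := n.s1 g c 1 (by simp) (hdv c hc) hf
    have hA : a2 * c + a3 ≠ 0 := by
      intro h
      have hb : b1 * c + b0 * c ^ 2 = 0 := by
        apply (mul_eq_zero.1 (?_ : a2 * _ = 0)).resolve_left h2
        linear_combination -hc + (2 * b1 + 3 * b0 * c) * h
      refine g.1 c 1 (by simp) ?_ ?_
      · simp only [ea]; linear_combination h
      · simp only [eb]; linear_combination c * hb
    obtain ⟨e, he⟩ : ∃ e, e * a2 = -(3 * b0 * c ^ 2 + 2 * b1 * c) :=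
      ⟨-(3 * b0 * c ^ 2 + 2 * b1 * c) / a2, by field_simp⟩
    have hee : b0 * c ^ 3 + b1 * c ^ 2 + e * (a2 * c + a3) = 0 := by
      apply (mul_eq_zero.1 (?_ : a2 * _ = 0)).resolve_left h2
      linear_combination -c * hc + (a2 * c + a3) * he
    have he2 : eb ⟨0, 0, a2, a3, b0, b1, 0, 0⟩ c 1 = -(a2 * c + a3) * e := by
      simp only [eb]; linear_combination hee
    have he3 : -ea ⟨0, 0, a2, a3, b0, b1, 0, 0⟩ c 1 = -(a2 * c + a3) * 1 := by
      simp only [ea]; ring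
    rw [he2, he3, sc_cn _ _ _ (neg_ne_zero.2 hA)] at h4
    have hne : e - c ≠ 0 := by
      intro h
      have : e = c := by linear_combination h
      rw [this] at h4
      exact hf h4
    have h5 : (e - c) ^ 2 * (b0 * e + 2 * b0 * c + b1) = 0 := by
      simp only [cn, ea, eb] at h4
      linear_combination h4 - hee - (e - c) * he
    have h6 := (mul_eq_zero.1 h5).resolve_left (pow_ne_zero 2 hne)
    have e0 : e ≠ 0 := by
      rintro rfl
      have : b0 * c ^ 2 = 0 := by linear_combination 2 * c * h6 - he
      exact mul_ne_zero h0 (pow_ne_zero 2 c0) this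
    refine ⟨e, by linear_combination h6, by linear_combination he - 2 * c * h6, ?_⟩
    apply mul_left_cancel₀ e0
    linear_combination hee - c * he + c ^ 2 * h6
  obtain ⟨e, k1, k2, k3⟩ := key z e1 f1
  obtain ⟨-, -, -, k4⟩ := key w e2 f2
  have z0 := hz0 z e1
  have hw : w = -z := by
    have : b0 * ((z - w) * (z + w)) = 0 := by linear_combination k3 - k4
    have := (mul_eq_zero.1 ((mul_eq_zero.1 this).resolve_left h0)).resolve_left (sub_ne_zero.2 hzw)
    linear_combination this
  subst hw
  have m1 : 3 * a3 * b0 + a2 * b1 = 0 := by linear_combination e3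
  have m2 : e ^ 2 + 4 * e * z + z ^ 2 = 0 := by
    apply (mul_eq_zero.1 (?_ : (2 * b0 ^ 2 * z) * _ = 0)).resolve_left (by simp [h0, z0])
    linear_combination -e * m1 + b1 * k2 + 3 * e * b0 * k3 + b0 * (z ^ 2 + 2 * z * e) * k1
  have m3 : b1 ^ 2 = 3 * b0 ^ 2 * z ^ 2 := by
    linear_combination (b1 - b0 * (2 * z + e)) * k1 + b0 ^ 2 * m2
  have m4 : a2 = b1 := by
    apply mul_right_cancel₀ h1
    linear_combination m1 - m3 - 3 * b0 * k3
  obtain ⟨β, hβ⟩ : ∃ β, b1 = -β * (b0 * z) := ⟨-b1 / (b0 * z), by field_simp⟩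
  have hβ2 : (β - s3) * (β + s3) = 0 := by
    apply (mul_eq_zero.1 (?_ : (b0 * z) ^ 2 * _ = 0)).resolve_left (by simp [h0, z0])
    rw [hβ] at m3
    linear_combination m3 - (b0 * z) ^ 2 * s3_sq
  have hs := s3_sq
  have hs0 := s3_ne
  subst m4; subst hβ; subst k3
  rcases mul_eq_zero.1 hβ2 with h | h
  · have : β = s3 := by linear_combination h
    subst this
    refine Rel.om (p := z) (q := 0) (r := 0) (s := 1) (k := -b0 * z ^ 3 / s3) 9 ⟨by simpa using z0, ?_, ?_⟩
    · simp [h0, z0, hs0]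
    rw [om9]; simp only [tr, smul, ea, eb, mk.injEq]
    refine ⟨?_, ?_, ?_, ?_, ?_, ?_, ?_, ?_⟩ <;> field_simp <;> grind
  · have : β = -s3 := by linear_combination h
    subst this
    refine Rel.om (p := -z) (q := 0) (r := 0) (s := 1) (k := b0 * z ^ 3 / s3) 9 ⟨by simpa using z0, ?_, ?_⟩
    · simp [h0, z0, hs0]
    rw [om9]; simp only [tr, smul, ea, eb, mk.injEq]
    refine ⟨?_, ?_, ?_, ?_, ?_, ?_, ?_, ?_⟩ <;> field_simp <;> grind

theorem caseII2 (c : Co) (g : c.Good) (n : c.NoD) (h1 : c.dv 1 0 = 0) (h2 : c.cn 1 0 = 0)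
    (h3 : c.dv 0 1 = 0) (h4 : c.cn 0 1 = 0) : c.Target := by
  obtain ⟨a0, a1, a2, a3, b0, b1, b2, b3⟩ := c
  simp [cn, ea] at h2
  subst h2
  simp [cn, eb] at h4
  subst h4
  have hb : b0 ≠ 0 := by
    rintro rfl
    exact g.1 1 0 (by simp) (by simp [ea]) (by simp [eb])
  have ha : a3 ≠ 0 := by
    rintro rfl
    exact g.1 0 1 (by simp) (by simp [ea]) (by simp [eb])
  simp [dv, d0, hb] at h1
  subst h1
  simp [dv, d4, ha] at h3
  subst h3
  refine caseII2c _ _ _ _ g n ?_ ha hb ?_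
  · rintro rfl
    exact n 1 0 (by simp) (by simp [dx, d0]) (by simp [dy, d1])
  · rintro rfl
    exact n 0 1 (by simp) (by simp [dx, d3]) (by simp [dy, d4])

theorem caseII12 (c : Co) (g : c.Good) (n : c.NoD) (x y : ℂ) (hx : x ≠ 0 ∨ y ≠ 0)
    (h1 : c.dv x y = 0) (h2 : c.cn x y = 0) : c.Target := by
  obtain ⟨u, v, hn⟩ := compl x y hx
  have R := rel_tr c x u y v hn
  have k1 := (R.dv (x := 1) (y := 0) (by simp)).2 (by simpa using h1)
  have k2 := (R.cn (x := 1) (y := 0)).2 (by simpa using h2)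
  refine R.target ?_
  have g := R.good g
  have n := R.nod n
  generalize c.tr x u y v = c at *
  obtain ⟨z, h3, h4⟩ := caseII1a c g n k1 k2
  have R := rel_tr c 1 z 0 1 (by simp)
  refine R.target (caseII2 _ (R.good g) (R.nod n) ?_ ?_ ?_ ?_)
  · rw [R.dv (by simp)]; simpa using k1
  · rw [R.cn]; simpa using k2
  · rw [R.dv (by simp)]; simpa using h3
  · rw [R.cn]; simpa using h4

/-! #### no fixed critical point -/

theorem caseII3b (b0 b1 b2 b3 : ℂ) (g : Good ⟨0, 1, 0, 0, b0, b1, b2, b3⟩)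
    (n : NoD ⟨0, 1, 0, 0, b0, b1, b2, b3⟩)
    (hn : ∀ x y, (x ≠ 0 ∨ y ≠ 0) → dv ⟨0, 1, 0, 0, b0, b1, b2, b3⟩ x y = 0 →
      cn ⟨0, 1, 0, 0, b0, b1, b2, b3⟩ x y ≠ 0) :
    Target ⟨0, 1, 0, 0, b0, b1, b2, b3⟩ := by
  have hb0 : b0 ≠ 0 := by
    rintro rfl
    exact g.1 1 0 (by simp) (by simp [ea]) (by simp [eb])
  have hb3 : b3 ≠ 0 := by
    rintro rfl
    exact g.1 0 1 (by simp) (by simp [ea]) (by simp [eb])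
  rcases cub_alt b0 0 (-b2) (-2 * b3) hb0 with ⟨z, h1, h2⟩ | ⟨z, w, t, n1, n2, n3, e1, e2, e3⟩
  · refine (n z 1 (by simp) ?_ ?_).elim
    · simp only [dx, d0, d1, d2, d3, d4]; linear_combination -3 * h1 - 3 * z * h2
    · simp only [dy, d0, d1, d2, d3, d4]; linear_combination -9 * z * h1 + 3 * z ^ 2 * h2
  have key : ∀ c : ℂ, b0 * c ^ 3 + 0 * c ^ 2 + -b2 * c + -2 * b3 = 0 →
      (b0 * (1 - 3 * b0)) * c ^ 2 + (-2 * b0 * b1) * c + (-(1 + b0) * b2) = 0 := by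
    intro c hc
    have c0 : c ≠ 0 := by
      rintro rfl; apply hb3; linear_combination -hc / 2
    have hd : dv ⟨0, 1, 0, 0, b0, b1, b2, b3⟩ c 1 = 0 := by
      simp only [dv, d0, d1, d2, d3, d4]; linear_combination -3 * c * hc
    have hf := hn c 1 (by simp) hd
    have h4 := n.s1 g c 1 (by simp) hd hf
    obtain ⟨e, he⟩ : ∃ e, 2 * c * e = -(3 * b0 * c ^ 2 + 2 * b1 * c + b2) :=
      ⟨-(3 * b0 * c ^ 2 + 2 * b1 * c + b2) / (2 * c), by field_simp⟩
    have hee : b0 * c ^ 3 + b1 * c ^ 2 + b2 * c + b3 + e * c ^ 2 = 0 := by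
      linear_combination c / 2 * he - hc / 2
    have he2 : eb ⟨0, 1, 0, 0, b0, b1, b2, b3⟩ c 1 = -c ^ 2 * e := by
      simp only [eb]; linear_combination hee
    have he3 : -ea ⟨0, 1, 0, 0, b0, b1, b2, b3⟩ c 1 = -c ^ 2 * 1 := by
      simp only [ea]; ring
    rw [he2, he3, sc_cn _ _ _ (neg_ne_zero.2 (pow_ne_zero 2 c0))] at h4
    have hne : e - c ≠ 0 := by
      intro h
      have : e = c := by linear_combination h
      rw [this] at h4
      exact hf h4
    have h5 : (e - c) ^ 2 * (b0 * e + 2 * b0 * c + b1 + e) = 0 := by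
      simp only [cn, ea, eb] at h4
      linear_combination h4 - hee - (e - c) * he
    have h6 := (mul_eq_zero.1 h5).resolve_left (pow_ne_zero 2 hne)
    linear_combination 2 * c * h6 - (1 + b0) * he
  obtain ⟨f1, f2, f3⟩ := quad_three n1 n2 n3 (key _ e1) (key _ e2) (key _ e3)
  have f1 : b0 = 1 / 3 := by
    have := (mul_eq_zero.1 f1).resolve_left hb0
    linear_combination -this / 3
  subst f1
  have f2 : b1 = 0 := by linear_combination -3 / 2 * f2
  have f3 : b2 = 0 := by linear_combination -3 / 4 * f3
  subst f2; subst f3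
  obtain ⟨p, hp⟩ := IsAlgClosed.exists_pow_nat_eq (6 * b3) (n := 3) (by norm_num)
  have hs := s3_sq
  have hs0 := s3_ne
  have hp0 : p ≠ 0 := by
    rintro rfl; apply hb3; linear_combination -hp / 6
  refine Rel.om (p := p) (q := 0) (r := 1) (s := s3) (k := 3 * b3) 10 ⟨by simp [hp0, hs0], by simp [hb3], ?_⟩
  rw [om10]; simp only [tr, smul, ea, eb, mk.injEq]
  refine ⟨?_, ?_, ?_, ?_, ?_, ?_, ?_, ?_⟩ <;> grind

theorem caseII3 (c : Co) (g : c.Good) (n : c.NoD)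
    (hn : ∀ x y, (x ≠ 0 ∨ y ≠ 0) → c.dv x y = 0 → c.cn x y ≠ 0) : c.Target := by
  obtain ⟨x, y, hx, hd⟩ : ∃ x y, (x ≠ 0 ∨ y ≠ 0) ∧ c.dv x y = 0 := by
    by_cases h : c.d0 = 0
    · exact ⟨1, 0, by simp, by simp [dv, h]⟩
    · obtain ⟨z, hz⟩ := qua_root c.d0 c.d1 c.d2 c.d3 c.d4 h
      exact ⟨z, 1, by simp, by simpa [dv] using hz⟩
  have hc := hn x y hx hd
  have hF := n.s1 g x y hx hd hc
  have R := rel_tr c (c.eb x y) x (-c.ea x y) y (by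
    intro h; apply hc; rw [cn]; linear_combination h)
  refine R.target ?_
  have k1 := (R.dv (x := 0) (y := 1) (by simp)).2 (by simpa using hd)
  have k2 := (R.cn (x := 1) (y := 0)).2 (by simpa using hF)
  have hn' : ∀ z w, (z ≠ 0 ∨ w ≠ 0) → (c.tr (c.eb x y) x (-c.ea x y) y).dv z w = 0 →
      (c.tr (c.eb x y) x (-c.ea x y) y).cn z w ≠ 0 := by
    intro z w hz h h'
    rw [R.dv hz] at h
    rw [R.cn] at h'
    exact hn _ _ (R.ne hz) h h'
  have k3 : (c.tr (c.eb x y) x (-c.ea x y) y).a3 = 0 := by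
    simp only [tr]; ring
  have g := R.good g
  have n := R.nod n
  clear R hn hd hF
  generalize c.tr (c.eb x y) x (-c.ea x y) y = c' at *
  obtain ⟨a0, a1, a2, a3, b0, b1, b2, b3⟩ := c'
  simp only at k3
  subst k3
  simp [cn, ea] at k2
  subst k2
  have hb0 : b0 ≠ 0 := by
    rintro rfl
    exact g.1 1 0 (by simp) (by simp [ea]) (by simp [eb])
  have hb3 : b3 ≠ 0 := by
    rintro rfl
    exact g.1 0 1 (by simp) (by simp [ea]) (by simp [eb])
  simp [dv, d4, hb3] at k1
  subst k1
  have ha : a1 ≠ 0 := by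
    rintro rfl
    exact hn' 1 0 (by simp) (by simp [dv, d0]) (by simp [cn, ea])
  have R : Rel ⟨0, a1, 0, 0, b0, b1, b2, b3⟩ ⟨0, 1, 0, 0, b0 / a1, b1 / a1, b2 / a1, b3 / a1⟩ 1 0 0 1 a1 := by
    refine ⟨by simp, ha, ?_⟩
    simp only [tr, smul, ea, eb, mk.injEq]
    refine ⟨?_, ?_, ?_, ?_, ?_, ?_, ?_, ?_⟩ <;> field_simp <;> ring
  refine R.target (caseII3b _ _ _ _ (R.good g) (R.nod n) ?_)
  intro z w hz h h'
  rw [R.dv hz] at h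
  rw [R.cn] at h'
  exact hn' _ _ (R.ne hz) h h'

theorem forward (c : Co) (g : c.Good) : c.Target := by
  by_cases n : c.NoD
  · by_cases h : ∃ x y, (x ≠ 0 ∨ y ≠ 0) ∧ c.dv x y = 0 ∧ c.cn x y = 0
    · obtain ⟨x, y, hx, h1, h2⟩ := h
      exact caseII12 c g n x y hx h1 h2
    · push Not at h
      exact caseII3 c g n h
  · exact caseI c g n

end Co

/-- **Flatness criterion and classification in degree 3.**
For `ω = A dx + B dy` with `A, B` homogeneous of degree 3 and coprime, the two
flatness conditions —
(1) for every linear form `ℓ = ax + by` dividing `D` with multiplicity exactly 1 and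
not dividing `C`, the linear form `A(b,−a)·x + B(b,−a)·y` divides `C`;
(2) for every linear form `ℓ` dividing `D` with multiplicity exactly 2 and not
dividing `C`, `ℓ` divides `B_x − A_y` —
hold if and only if `ω` is linearly conjugate to one of the eleven 1-forms
`ω₁, …, ω₁₁`; moreover these eleven 1-forms are pairwise not linearly conjugate. -/
theorem stmt_4 (A B : MvPolynomial (Fin 2) ℂ)
    (hA : A.IsHomogeneous 3) (hB : B.IsHomogeneous 3)
    (hcop : ∀ p : MvPolynomial (Fin 2) ℂ, p ∣ A → p ∣ B → IsUnit p) :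
    (((∀ a b : ℂ, (a, b) ≠ (0, 0) →
        lin (a, b) ∣ Dpoly A B → ¬ lin (a, b) ^ 2 ∣ Dpoly A B →
        ¬ lin (a, b) ∣ cone A B →
        lin (eval ![b, -a] A, eval ![b, -a] B) ∣ cone A B) ∧
      (∀ a b : ℂ, (a, b) ≠ (0, 0) →
        lin (a, b) ^ 2 ∣ Dpoly A B → ¬ lin (a, b) ^ 3 ∣ Dpoly A B →
        ¬ lin (a, b) ∣ cone A B →
        lin (a, b) ∣ (pderiv 0 B - pderiv 1 A))) ↔
      ∃ i : Fin 11, LinConj2 A B (omegaList i).1 (omegaList i).2) ∧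
    (∀ i j : Fin 11, i ≠ j →
      ¬ LinConj2 (omegaList i).1 (omegaList i).2 (omegaList j).1 (omegaList j).2) := by
  obtain ⟨a0, a1, a2, a3, rfl⟩ := exists_cub hA
  obtain ⟨b0, b1, b2, b3, rfl⟩ := exists_cub hB
  have main : ∀ c : Co, (∀ p : MvPolynomial (Fin 2) ℂ, p ∣ c.PA → p ∣ c.PB → IsUnit p) →
      (FlatP c.PA c.PB ↔ ∃ i : Fin 11, LinConj2 c.PA c.PB (omegaList i).1 (omegaList i).2) := by
    intro c hc
    constructor
    · intro h
      have hnz : c.NZ := by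
        intro x y hxy h1 h2
        have hp : ((x, y) : ℂ × ℂ) ≠ 0 := Co.ne_pt hxy
        have d1 : lin (-y, x) ∣ c.PA :=
          (lin_dvd_iff (cub_hom _ _ _ _) (x, y) hp).2 (by rw [← h1]; exact Co.ev_PA)
        have d2 : lin (-y, x) ∣ c.PB :=
          (lin_dvd_iff (cub_hom _ _ _ _) (x, y) hp).2 (by rw [← h2]; exact Co.ev_PB)
        have hu := (hc _ d1 d2).map (eval ![(0 : ℂ), 0])
        simp [lin] at hu
      obtain ⟨i, hi⟩ := c.forward ⟨hnz, h⟩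
      refine ⟨i, ?_⟩
      rw [om_eq]
      exact hi
    · rintro ⟨i, M, k, h⟩
      rw [om_eq] at h
      have h' : ConjM c.PA c.PB (om i).PA (om i).PB M k := h
      exact (conj_flat h').1 (Co.flat_of_eflat (Co.om_flat i))
  refine ⟨?_, ?_⟩
  · rw [flatP_iff]
    exact main ⟨a0, a1, a2, a3, b0, b1, b2, b3⟩ hcop
  · intro i j hij
    rw [om_eq, om_eq]
    exact Co.nonconj i j hij
end
end

section
/- Let A, B, C ∈ ℂ[x,y] be homogeneous of degree 3 and let F be the degree-three foliation of ℙ²(ℂ) defined in the affine chart z = 1 by ω = A dx + B dy + C·(x dy − y dx), i.e. by the homogeneous 1-form Ω = (zA − yC)dx + (zB + xC)dy − (xA + yB)dz. Assume that the only common zeros of the three polynomials zA − yC, zB + xC, xA + yB in ℂ³∖{0} are the nonzero multiples of (0,0,1) (i.e. the only singular point of F is O = [0:0:1]), and that xA + yB ≠ 0. Then every irreducible factor of xA + yB in ℂ[x,y] divides both A and B, and does not divide C. In particular, xA + yB cannot be a product of four pairwise non-proportional linear forms. -/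
open MvPolynomial

noncomputable section

/-- The inclusion `ℂ[x,y] → ℂ[x,y,z]`. -/
def emb : MvPolynomial (Fin 2) ℂ →ₐ[ℂ] MvPolynomial (Fin 3) ℂ :=
  rename Fin.castSucc

/-- The homogeneous projective 1-form
`Ω = (zA − yC) dx + (zB + xC) dy − (xA + yB) dz`
associated to the affine 1-form `ω = A dx + B dy + C (x dy − y dx)` of a degree-3
foliation with a singular point of algebraic multiplicity 3 at the origin
(`A`, `B`, `C` homogeneous of degree 3). -/
def OmABC (A B Cc : MvPolynomial (Fin 2) ℂ) : Fin 3 → MvPolynomial (Fin 3) ℂ :=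
  ![X 2 * emb A - X 1 * emb Cc,
    X 2 * emb B + X 0 * emb Cc,
    -(X 0 * emb A + X 1 * emb B)]

/-- Substitution of the linear change of variables on `ℂ³` given by the matrix `M`. -/
def subst3 (M : Matrix (Fin 3) (Fin 3) ℂ) (P : MvPolynomial (Fin 3) ℂ) :
    MvPolynomial (Fin 3) ℂ :=
  aeval (fun i => ∑ j, C (M i j) * X j) P

/-- Pullback of the 1-form with coefficient vector `Ω` by the linear map of matrix `M`. -/
def pb3 (M : Matrix (Fin 3) (Fin 3) ℂ) (Ω : Fin 3 → MvPolynomial (Fin 3) ℂ) :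
    Fin 3 → MvPolynomial (Fin 3) ℂ :=
  fun i => ∑ j, C (M j i) * subst3 M (Ω j)

/-- Two projective 1-forms are linearly conjugate: `T*Ω = c·Ω'` for some
`T ∈ GL₃(ℂ)` and `c ∈ ℂ*`. -/
def LinConj3 (Ω Ω' : Fin 3 → MvPolynomial (Fin 3) ℂ) : Prop :=
  ∃ (M : Matrix (Fin 3) (Fin 3) ℂ) (c : ℂ), IsUnit M.det ∧ c ≠ 0 ∧
    pb3 M Ω = fun i => C c * Ω' i

/-- The linear form `a·x + b·y ∈ ℂ[x,y]`. -/
def lin2 (v : ℂ × ℂ) : MvPolynomial (Fin 2) ℂ := C v.1 * X 0 + C v.2 * X 1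

lemma dvd_of_vanish {p q : MvPolynomial (Fin 2) ℂ} (hp : Irreducible p)
    (h : ∀ x : Fin 2 → ℂ, eval x p = 0 → eval x q = 0) : p ∣ q := by
  have h1 : q ∈ vanishingIdeal ℂ (zeroLocus ℂ (Ideal.span {p})) := by
    rw [mem_vanishingIdeal_iff]
    intro x hx
    have h2 := hx p (Ideal.subset_span rfl)
    rw [aeval_eq_eval] at h2 ⊢
    exact h x h2
  rw [vanishingIdeal_zeroLocus_eq_radical] at h1
  obtain ⟨n, hn⟩ := h1
  rw [Ideal.mem_span_singleton] at hn
  exact hp.prime.dvd_of_dvd_pow hn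

lemma not_dvd_both {p : MvPolynomial (Fin 2) ℂ} (hp : Irreducible p)
    (h0 : p ∣ X 0) (h1 : p ∣ X 1) : False := by
  have h := (hp.associated_of_dvd (X_prime (R := ℂ) (i := (0 : Fin 2))).irreducible h0)
  have h2 := h.symm.dvd.trans h1
  rw [X_dvd_X] at h2
  exact absurd h2 (by decide)

lemma exists_zero {p : MvPolynomial (Fin 2) ℂ} (hp : Irreducible p) :
    ∃ x : Fin 2 → ℂ, x ≠ 0 ∧ eval x p = 0 := by
  by_contra! hc
  have key : ∀ i : Fin 2, p ∣ X i := fun i => dvd_of_vanish hp fun x hx => by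
    have : x = 0 := by
      by_contra hne
      exact hc x hne hx
    simp [this]
  exact not_dvd_both hp (key 0) (key 1)

lemma irr_lin2 {v : ℂ × ℂ} (hv : lin2 v ≠ 0) : Irreducible (lin2 v) := by
  have hh : (lin2 v).IsHomogeneous 1 := by
    unfold lin2
    refine IsHomogeneous.add ?_ ?_
    · simpa using (isHomogeneous_C (Fin 2) v.1).mul (isHomogeneous_X ℂ (0 : Fin 2))
    · simpa using (isHomogeneous_C (Fin 2) v.2).mul (isHomogeneous_X ℂ (1 : Fin 2))
  refine irreducible_of_totalDegree_eq_one (hh.totalDegree hv) fun x hx => ?_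
  rw [isUnit_iff_ne_zero]
  rintro rfl
  apply hv
  ext i
  simpa using hx i

lemma relprime_lin2 {v w : ℂ × ℂ} (h : v.1 * w.2 - w.1 * v.2 ≠ 0) :
    IsRelPrime (lin2 v) (lin2 w) := by
  have hv : lin2 v ≠ 0 := by
    intro h0
    apply h
    have e1 := congrArg (eval ![1, 0]) h0
    have e2 := congrArg (eval ![0, 1]) h0
    simp [lin2] at e1 e2
    simp [e1, e2]
  refine (irr_lin2 hv).isRelPrime_iff_not_dvd.2 fun ⟨q, hq⟩ => h ?_
  have e := congrArg (eval ![v.2, -v.1]) hq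
  simp [lin2] at e
  linear_combination (exp := 1) -e

lemma eval_zero_hom {A : MvPolynomial (Fin 2) ℂ} (hA : A.IsHomogeneous 3) :
    eval 0 A = 0 := by
  rw [eval_zero, constantCoeff_eq]
  exact hA.coeff_eq_zero (by simp)

lemma eval_emb (v : Fin 3 → ℂ) (A : MvPolynomial (Fin 2) ℂ) :
    eval v (emb A) = eval ![v 0, v 1] A := by
  rw [emb, eval_rename]
  congr 2
  ext i
  fin_cases i <;> rfl

/-- **Factors of the tangent cone of a degree-3 foliation with a single singular point.**
Let `A, B, C ∈ ℂ[x,y]` be homogeneous of degree 3 and let `F` be the degree-3 foliation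
defined by `Ω = (zA − yC)dx + (zB + xC)dy − (xA + yB)dz`.  Assume the only common zeros
of the three coefficients of `Ω` in `ℂ³ ∖ {0}` are the nonzero multiples of `(0,0,1)`,
and that `xA + yB ≠ 0`.  Then every irreducible factor of `xA + yB` divides both `A` and
`B` and does not divide `C`; in particular `xA + yB` is not a product of four pairwise
non-proportional linear forms. -/
theorem stmt_5 (A B Cc : MvPolynomial (Fin 2) ℂ)
    (hA : A.IsHomogeneous 3) (hB : B.IsHomogeneous 3) (hC : Cc.IsHomogeneous 3)
    (hcone : X 0 * A + X 1 * B ≠ 0)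
    (hsing : ∀ v : Fin 3 → ℂ, v ≠ 0 →
      ((∀ i, eval v (OmABC A B Cc i) = 0) ↔ (v 0 = 0 ∧ v 1 = 0))) :
    (∀ p : MvPolynomial (Fin 2) ℂ, Irreducible p → p ∣ X 0 * A + X 1 * B →
      p ∣ A ∧ p ∣ B ∧ ¬ p ∣ Cc) ∧
    ¬ ∃ (c : ℂ) (L : Fin 4 → ℂ × ℂ), c ≠ 0 ∧
        (∀ i j, i ≠ j → (L i).1 * (L j).2 - (L j).1 * (L i).2 ≠ 0) ∧
        X 0 * A + X 1 * B = C c * ∏ i, lin2 (L i) := by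
  have key : ∀ x : Fin 2 → ℂ, x ≠ 0 → eval x (X 0 * A + X 1 * B) = 0 →
      eval x A = 0 ∧ eval x B = 0 ∧ eval x Cc ≠ 0 := by
    intro x hx h0
    have hxx : (![x 0, x 1] : Fin 2 → ℂ) = x := by ext i; fin_cases i <;> rfl
    have hx2 : ¬ (x 0 = 0 ∧ x 1 = 0) := by
      rintro ⟨h1, h2⟩
      apply hx
      ext i; fin_cases i <;> assumption
    have hs : ∀ z : ℂ, z * eval x A - x 1 * eval x Cc = 0 →
        z * eval x B + x 0 * eval x Cc = 0 → False := by
      intro z h1 h2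
      have hv : (![x 0, x 1, z] : Fin 3 → ℂ) ≠ 0 := by
        intro h
        exact hx2 ⟨congrFun h 0, congrFun h 1⟩
      apply hx2
      have := (hsing _ hv).1 ?_
      · simpa using this
      · intro i
        fin_cases i
        · simpa [OmABC, eval_emb, hxx] using h1
        · simpa [OmABC, eval_emb, hxx] using h2
        · simp at h0
          simp [OmABC, eval_emb, hxx]
          linear_combination -h0
    simp only [map_add, map_mul, eval_X] at h0
    generalize eval x A = a at *
    generalize eval x B = b at *
    generalize eval x Cc = c at *
    have hab : a = 0 ∧ b = 0 := by
      by_cases hx0 : x 0 = 0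
      · have hx1 : x 1 ≠ 0 := fun h => hx2 ⟨hx0, h⟩
        have hb : b = 0 := by simpa [hx0, hx1] using h0
        refine ⟨?_, hb⟩
        by_contra ha
        refine hs (x 1 * c / a) ?_ ?_
        · field_simp; ring
        · simp [hb, hx0]
      · by_cases hb : b = 0
        · refine ⟨?_, hb⟩
          simpa [hb, hx0] using h0
        · exfalso
          refine hs (-(x 0 * c) / b) ?_ ?_
          · field_simp; linear_combination (-c) * h0
          · field_simp; ring
    refine ⟨hab.1, hab.2, fun hc => hs 0 ?_ ?_⟩ <;> simp [hc]
  have main : ∀ p : MvPolynomial (Fin 2) ℂ, Irreducible p → p ∣ X 0 * A + X 1 * B →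
      p ∣ A ∧ p ∣ B ∧ ¬ p ∣ Cc := by
    intro p hp hd
    have hz : ∀ x : Fin 2 → ℂ, eval x p = 0 → eval x (X 0 * A + X 1 * B) = 0 := by
      intro x hx
      obtain ⟨q, hq⟩ := hd
      rw [hq, map_mul, hx, zero_mul]
    refine ⟨dvd_of_vanish hp fun x hx => ?_, dvd_of_vanish hp fun x hx => ?_, ?_⟩
    · by_cases h : x = 0
      · rw [h, eval_zero_hom hA]
      · exact (key x h (hz x hx)).1
    · by_cases h : x = 0
      · rw [h, eval_zero_hom hB]
      · exact (key x h (hz x hx)).2.1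
    · rintro ⟨q, hq⟩
      obtain ⟨x, hx, hpx⟩ := exists_zero hp
      apply (key x hx (hz x hpx)).2.2
      rw [hq, map_mul, hpx, zero_mul]
  refine ⟨main, ?_⟩
  rintro ⟨c, L, hc, hL, hF⟩
  have hne : ∏ i, lin2 (L i) ≠ 0 := by
    intro h
    rw [h, mul_zero] at hF
    exact hcone hF
  have hirr : ∀ i, Irreducible (lin2 (L i)) := fun i =>
    irr_lin2 ((Finset.prod_ne_zero_iff.1 hne) i (Finset.mem_univ i))
  have hdv : ∀ i, lin2 (L i) ∣ X 0 * A + X 1 * B := fun i => by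
    rw [hF]
    exact (Finset.dvd_prod_of_mem _ (Finset.mem_univ i)).mul_left _
  have hpair : ((Finset.univ : Finset (Fin 4)) : Set (Fin 4)).Pairwise
      (Function.onFun IsRelPrime fun i => lin2 (L i)) :=
    fun i _ j _ hij => relprime_lin2 (hL i j hij)
  obtain ⟨q, hq⟩ : ∏ i, lin2 (L i) ∣ A :=
    Finset.prod_dvd_of_isRelPrime hpair fun i _ => (main _ (hirr i) (hdv i)).1
  obtain ⟨r, hr⟩ : ∏ i, lin2 (L i) ∣ B :=
    Finset.prod_dvd_of_isRelPrime hpair fun i _ => (main _ (hirr i) (hdv i)).2.1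
  generalize ∏ i, lin2 (L i) = P at *
  have h : P * (X 0 * q + X 1 * r) = P * C c := by
    rw [hq, hr] at hF
    linear_combination hF
  have h2 := congrArg (eval 0) (mul_left_cancel₀ hne h)
  simp at h2
  exact hc h2.symm
end
end
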